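/- arXiv:2508.18792 — 2 statements merged into one kernel-verified Lean document; each statement's English description precedes it below -/
import Mathlib

section
/- For every θ ∈ [0,π), the sequence n^{3/2}·x_c^n·G_n(θ) converges, as n → ∞, to c₀·J₀(θ·c₀/π)/(2√2·π^{5/2}), where x_c := c₀·J₁(c₀)/(2π²). (Coefficient asymptotics, Lemma 3.3 of the paper.) -/
open MeasureTheory Real

noncomputable def J0 (x : ℝ) : ℝ :=
  ∑' k : ℕ, (-1 : ℝ) ^ k * (x / 2) ^ (2 * k) / ((Nat.factorial k : ℝ)) ^ 2

noncomputable def J1 (x : ℝ) : ℝ :=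
  ∑' k : ℕ, (-1 : ℝ) ^ k * (x / 2) ^ (2 * k + 1) /
    ((Nat.factorial k : ℝ) * (Nat.factorial (k + 1) : ℝ))

noncomputable def c0 : ℝ := sInf {x : ℝ | 0 < x ∧ J0 x = 0}

inductive BinTree : Type
  | leaf : BinTree
  | node : BinTree → BinTree → BinTree

def BinTree.leaves : BinTree → ℕ
  | .leaf => 1
  | .node l r => l.leaves + r.leaves

noncomputable def mAngle : BinTree → ℝ → ℝ
  | .leaf, _ => 1
  | .node l r, θ =>
      ∫ α in (0:ℝ)..Real.pi, ∫ β in (0:ℝ)..Real.pi,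
        if θ < α + β ∧ α + β < Real.pi then mAngle l α * mAngle r β else 0

noncomputable def G (n : ℕ) (θ : ℝ) : ℝ :=
  ∑' τ : {τ : BinTree // τ.leaves = n}, mAngle τ.1 θ

noncomputable def Sfun (y : ℝ) : ℝ := Real.sqrt y / Real.pi * J1 (2 * Real.pi * Real.sqrt y)

noncomputable def xc : ℝ := c0 * J1 c0 / (2 * Real.pi ^ 2)

section Convolution

open Polynomial

/-- The evaluation at `θ` of the even function `∑ₖ pₖ θ^(2k) / (2k)!` attached to `p`. -/
noncomputable def evenEval (θ : ℝ) : ℝ[X] →ₗ[ℝ] ℝ :=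
  Polynomial.lsum fun k => (θ ^ (2 * k) / (2 * k).factorial) • LinearMap.id

lemma evenEval_monomial (θ : ℝ) (k : ℕ) (a : ℝ) :
    evenEval θ (monomial k a) = a * (θ ^ (2 * k) / (2 * k).factorial) := by
  simp [evenEval, Polynomial.lsum_apply, Polynomial.sum_monomial_index, mul_comm]

lemma evenEval_C (θ a : ℝ) : evenEval θ (C a) = a := by
  simpa using evenEval_monomial θ 0 a

lemma continuous_evenEval (p : ℝ[X]) : Continuous fun θ => evenEval θ p := by
  induction p using Polynomial.induction_on' with
  | add p q hp hq =>
    simp only [map_add]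
    exact hp.add hq
  | monomial k a => simp only [evenEval_monomial]; fun_prop

lemma integral_pow_div_mul_sub_pow_div (s : ℝ) (a b : ℕ) :
    ∫ x in (0 : ℝ)..s, x ^ a / a.factorial * ((s - x) ^ b / b.factorial) =
      s ^ (a + b + 1) / (a + b + 1).factorial := by
  induction b generalizing a with
  | zero =>
    simp only [pow_zero, Nat.factorial_zero, Nat.cast_one, div_one, mul_one, add_zero,
      intervalIntegral.integral_div, integral_pow, Nat.factorial_succ]
    push_cast
    have : (a.factorial : ℝ) ≠ 0 := by positivity
    have : (a : ℝ) + 1 ≠ 0 := by positivity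
    field_simp
    simp
  | succ b ih =>
    have hd : ∀ x : ℝ, HasDerivAt
        (fun x => x ^ (a + 1) / (a + 1).factorial * ((s - x) ^ (b + 1) / (b + 1).factorial))
        (x ^ a / a.factorial * ((s - x) ^ (b + 1) / (b + 1).factorial) -
          x ^ (a + 1) / (a + 1).factorial * ((s - x) ^ b / b.factorial)) x := by
      intro x
      have h1 := ((hasDerivAt_pow (a + 1) x).div_const ((a + 1).factorial : ℝ)).mul
        ((((hasDerivAt_id x).const_sub s).pow (b + 1)).div_const ((b + 1).factorial : ℝ))
      refine h1.congr_deriv ?_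
      simp only [Nat.factorial_succ, id, Nat.add_sub_cancel, Pi.pow_apply]
      have : (a.factorial : ℝ) ≠ 0 := by positivity
      have : (b.factorial : ℝ) ≠ 0 := by positivity
      have : (a : ℝ) + 1 ≠ 0 := by positivity
      have : (b : ℝ) + 1 ≠ 0 := by positivity
      push_cast
      field_simp
      ring
    have h2 := intervalIntegral.integral_eq_sub_of_hasDerivAt (a := 0) (b := s)
      (fun x _ => hd x) (by apply Continuous.intervalIntegrable; fun_prop)
    rw [intervalIntegral.integral_sub (by apply Continuous.intervalIntegrable; fun_prop)
      (by apply Continuous.intervalIntegrable; fun_prop), ih (a + 1)] at h2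
    have h3 : a + 1 + b + 1 = a + (b + 1) + 1 := by ring
    rw [h3] at h2
    simp at h2
    linarith

lemma continuous_integral_of_continuous {g : ℝ → ℝ} (hg : Continuous g) :
    Continuous fun s => ∫ x in (0 : ℝ)..s, g x :=
  intervalIntegral.continuous_primitive (fun _ _ => hg.intervalIntegrable _ _) 0

lemma integral_evenEval_mul_integral (p q : ℝ[X]) (s : ℝ) :
    ∫ x in (0 : ℝ)..s, evenEval x p * ∫ y in (0 : ℝ)..(s - x), evenEval y q =
      evenEval s (X * p * q) := by
  have hc : ∀ p q : ℝ[X], Continuous fun x =>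
      evenEval x p * ∫ y in (0 : ℝ)..(s - x), evenEval y q := fun p q =>
    (continuous_evenEval p).mul ((continuous_integral_of_continuous
      (continuous_evenEval q)).comp (continuous_const.sub continuous_id))
  induction p using Polynomial.induction_on' with
  | add p p' hp hp' =>
    simp only [map_add, add_mul, mul_add]
    rw [intervalIntegral.integral_add ((hc p q).intervalIntegrable _ _)
      ((hc p' q).intervalIntegrable _ _), hp, hp']
  | monomial k a =>
    induction q using Polynomial.induction_on' with
    | add q q' hq hq' =>
      have : ∀ x, ∫ y in (0 : ℝ)..(s - x), evenEval y (q + q') =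
          (∫ y in (0 : ℝ)..(s - x), evenEval y q) + ∫ y in (0 : ℝ)..(s - x), evenEval y q' := by
        intro x
        simp only [map_add]
        exact intervalIntegral.integral_add ((continuous_evenEval q).intervalIntegrable _ _)
          ((continuous_evenEval q').intervalIntegrable _ _)
      simp only [this, mul_add]
      rw [intervalIntegral.integral_add ((hc _ q).intervalIntegrable _ _)
        ((hc _ q').intervalIntegrable _ _), hq, hq', map_add]
    | monomial l b =>
      have h : ∀ x, evenEval x (monomial k a) * ∫ y in (0 : ℝ)..(s - x), evenEval y (monomial l b)
          = a * b * (x ^ (2 * k) / (2 * k).factorial *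
            ((s - x) ^ (2 * l + 1) / (2 * l + 1).factorial)) := by
        intro x
        simp only [evenEval_monomial, intervalIntegral.integral_const_mul,
          intervalIntegral.integral_div, integral_pow, Nat.factorial_succ]
        push_cast
        have : ((2 * l).factorial : ℝ) ≠ 0 := by positivity
        have : ((2 * k).factorial : ℝ) ≠ 0 := by positivity
        have : (2 * (l : ℝ)) + 1 ≠ 0 := by positivity
        field_simp
        simp
      simp only [h, intervalIntegral.integral_const_mul, integral_pow_div_mul_sub_pow_div]
      rw [X_mul_monomial, monomial_mul_monomial, evenEval_monomial]
      congr 3 <;> ring_nf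

lemma integral_ite_lt_add_lt {f g : ℝ → ℝ} (hf : Continuous f) (hg : Continuous g) {θ b : ℝ}
    (h0 : 0 ≤ θ) (hb : θ ≤ b) :
    (∫ x in (0 : ℝ)..b, ∫ y in (0 : ℝ)..b, if θ < x + y ∧ x + y < b then f x * g y else 0) =
      (∫ x in (0 : ℝ)..b, f x * ∫ y in (0 : ℝ)..(b - x), g y) -
        ∫ x in (0 : ℝ)..θ, f x * ∫ y in (0 : ℝ)..(θ - x), g y := by
  set K : ℝ → ℝ := fun s => ∫ y in (0 : ℝ)..s, g y with hK
  have hKc : Continuous K := continuous_integral_of_continuous hg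
  have hin : ∀ x ∈ Set.uIcc 0 b,
      (∫ y in (0 : ℝ)..b, if θ < x + y ∧ x + y < b then f x * g y else 0) =
        f x * K (b - x) - f x * K (max (θ - x) 0) := by
    intro x hx
    rw [Set.uIcc_of_le (h0.trans hb)] at hx
    have hm : max (θ - x) 0 ≤ b - x := max_le (by linarith) (by linarith [hx.2])
    have e1 : (fun y => if θ < x + y ∧ x + y < b then f x * g y else 0) =
        Set.indicator (Set.Ioo (θ - x) (b - x)) fun y => f x * g y := by
      ext y
      simp only [Set.indicator, Set.mem_Ioo]
      congr 1
      exact propext ⟨fun h => ⟨by linarith [h.1], by linarith [h.2]⟩,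
        fun h => ⟨by linarith [h.1], by linarith [h.2]⟩⟩
    rw [e1, intervalIntegral.integral_of_le (h0.trans hb),
      setIntegral_indicator measurableSet_Ioo]
    have e2 : Set.Ioc 0 b ∩ Set.Ioo (θ - x) (b - x) = Set.Ioo (max (θ - x) 0) (b - x) := by
      ext y
      simp only [Set.mem_inter_iff, Set.mem_Ioc, Set.mem_Ioo, max_lt_iff]
      exact ⟨fun h => ⟨⟨h.2.1, h.1.1⟩, h.2.2⟩,
        fun h => ⟨⟨h.1.2, by linarith [hx.1, h.2]⟩, h.1.1, h.2⟩⟩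
    rw [e2, ← integral_Ioc_eq_integral_Ioo, ← intervalIntegral.integral_of_le hm,
      intervalIntegral.integral_const_mul, ← mul_sub]
    congr 1
    rw [hK]
    exact (intervalIntegral.integral_interval_sub_left (hg.intervalIntegrable _ _)
      (hg.intervalIntegrable _ _)).symm
  rw [intervalIntegral.integral_congr hin, intervalIntegral.integral_sub
    (by apply Continuous.intervalIntegrable; fun_prop)
    (by apply Continuous.intervalIntegrable; fun_prop)]
  congr 1
  rw [← intervalIntegral.integral_add_adjacent_intervals (b := θ)
    (by apply Continuous.intervalIntegrable; fun_prop)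
    (by apply Continuous.intervalIntegrable; fun_prop)]
  have e3 : ∫ x in θ..b, f x * K (max (θ - x) 0) = ∫ x in θ..b, (0 : ℝ) := by
    apply intervalIntegral.integral_congr
    intro x hx
    rw [Set.uIcc_of_le hb] at hx
    simp [max_eq_right (by linarith [hx.1] : θ - x ≤ 0), hK]
  rw [e3, intervalIntegral.integral_zero, add_zero]
  apply intervalIntegral.integral_congr
  intro x hx
  rw [Set.uIcc_of_le h0] at hx
  simp [max_eq_left (by linarith [hx.2] : 0 ≤ θ - x), hK]

end Convolution

section Trees

open Polynomial

/-- The polynomial `p` such that `mAngle τ` is `fun θ => evenEval θ p` on `[0, π]`. -/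
noncomputable def BinTree.poly : BinTree → ℝ[X]
  | .leaf => 1
  | .node l r => C (evenEval π (X * l.poly * r.poly)) - X * l.poly * r.poly

lemma mAngle_eq_evenEval (τ : BinTree) {θ : ℝ} (h0 : 0 ≤ θ) (hπ : θ ≤ π) :
    mAngle τ θ = evenEval θ τ.poly := by
  induction τ generalizing θ with
  | leaf => simpa [mAngle, BinTree.poly] using (evenEval_C θ 1).symm
  | node l r hl hr =>
    have h : mAngle (.node l r) θ = ∫ x in (0 : ℝ)..π, ∫ y in (0 : ℝ)..π,
        if θ < x + y ∧ x + y < π then evenEval x l.poly * evenEval y r.poly else 0 := by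
      rw [mAngle]
      refine intervalIntegral.integral_congr fun x hx => ?_
      refine intervalIntegral.integral_congr fun y hy => ?_
      rw [Set.uIcc_of_le pi_pos.le] at hx hy
      simp only [hl hx.1 hx.2, hr hy.1 hy.2]
    rw [h, integral_ite_lt_add_lt (continuous_evenEval _) (continuous_evenEval _) h0 hπ,
      integral_evenEval_mul_integral, integral_evenEval_mul_integral, BinTree.poly, map_sub,
      evenEval_C]

lemma BinTree.leaves_pos (τ : BinTree) : 0 < τ.leaves := by
  induction τ with
  | leaf => simp [BinTree.leaves]
  | node l r hl hr => simp only [BinTree.leaves]; omega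

/-- A tree with at least two leaves is a pair of trees. -/
def BinTree.splitEquiv (n : ℕ) :
    {τ : BinTree // τ.leaves = n + 2} ≃
      Σ p : Finset.HasAntidiagonal.antidiagonal (n + 2),
        {l : BinTree // l.leaves = p.1.1} × {r : BinTree // r.leaves = p.1.2} where
  toFun
    | ⟨.leaf, h⟩ => by simp [BinTree.leaves] at h
    | ⟨.node l r, h⟩ =>
      ⟨⟨(l.leaves, r.leaves), by simpa [BinTree.leaves] using h⟩, ⟨l, rfl⟩, ⟨r, rfl⟩⟩
  invFun x := ⟨.node x.2.1.1 x.2.2.1, by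
    have h := Finset.HasAntidiagonal.mem_antidiagonal.1 x.1.2
    simp only [BinTree.leaves, x.2.1.2, x.2.2.2, h]⟩
  left_inv
    | ⟨.leaf, h⟩ => by simp [BinTree.leaves] at h
    | ⟨.node l r, h⟩ => rfl
  right_inv := by
    rintro ⟨⟨⟨i, j⟩, h⟩, ⟨l, hl⟩, ⟨r, hr⟩⟩
    dsimp only at hl hr
    subst hl hr
    rfl

instance BinTree.finite_leaves_eq (n : ℕ) : Finite {τ : BinTree // τ.leaves = n} := by
  induction n using Nat.strong_induction_on with
  | _ n ih =>
    match n, ih with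
    | 0, _ =>
      have : IsEmpty {τ : BinTree // τ.leaves = 0} :=
        ⟨fun τ => absurd τ.2 τ.1.leaves_pos.ne'⟩
      infer_instance
    | 1, _ =>
      have : Subsingleton {τ : BinTree // τ.leaves = 1} := by
        have h : ∀ τ : BinTree, τ.leaves = 1 → τ = .leaf := by
          rintro (_ | ⟨l, r⟩) h
          · rfl
          · have := l.leaves_pos
            have := r.leaves_pos
            simp only [BinTree.leaves] at h
            omega
        exact ⟨fun a b => Subtype.ext ((h _ a.2).trans (h _ b.2).symm)⟩
      infer_instance
    | n + 2, ih =>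
      have : ∀ p : Finset.HasAntidiagonal.antidiagonal (n + 2), Finite
          ({l : BinTree // l.leaves = p.1.1} × {r : BinTree // r.leaves = p.1.2}) := by
        rintro ⟨⟨i, j⟩, h⟩
        rw [Finset.HasAntidiagonal.mem_antidiagonal] at h
        dsimp only at h ⊢
        by_cases hi : i = 0
        · subst hi
          have : IsEmpty {τ : BinTree // τ.leaves = 0} :=
            ⟨fun τ => absurd τ.2 τ.1.leaves_pos.ne'⟩
          infer_instance
        by_cases hj : j = 0
        · subst hj
          have : IsEmpty {τ : BinTree // τ.leaves = 0} :=
            ⟨fun τ => absurd τ.2 τ.1.leaves_pos.ne'⟩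
          infer_instance
        have := ih i (by omega)
        have := ih j (by omega)
        infer_instance
      exact Finite.of_equiv _ (BinTree.splitEquiv n).symm

/-- The polynomial giving `G n` on `[0, π]`. -/
noncomputable def polyG (n : ℕ) : ℝ[X] :=
  ∑ᶠ τ : {τ : BinTree // τ.leaves = n}, τ.1.poly

lemma G_eq_evenEval (n : ℕ) {θ : ℝ} (h0 : 0 ≤ θ) (hπ : θ ≤ π) :
    G n θ = evenEval θ (polyG n) := by
  have := Fintype.ofFinite {τ : BinTree // τ.leaves = n}
  rw [G, polyG, tsum_fintype, finsum_eq_sum_of_fintype, map_sum]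
  exact Finset.sum_congr rfl fun τ _ => mAngle_eq_evenEval _ h0 hπ

lemma polyG_zero : polyG 0 = 0 := by
  have : IsEmpty {τ : BinTree // τ.leaves = 0} :=
    ⟨fun τ => absurd τ.2 τ.1.leaves_pos.ne'⟩
  rw [polyG, finsum_of_isEmpty]

lemma polyG_one : polyG 1 = 1 := by
  have h : ∀ τ : {τ : BinTree // τ.leaves = 1}, τ = ⟨.leaf, rfl⟩ := by
    rintro ⟨_ | ⟨l, r⟩, h⟩
    · rfl
    · have := l.leaves_pos
      have := r.leaves_pos
      simp only [BinTree.leaves] at h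
      omega
  have : Unique {τ : BinTree // τ.leaves = 1} := ⟨⟨⟨.leaf, rfl⟩⟩, h⟩
  rw [polyG, finsum_unique, h default, BinTree.poly]

lemma polyG_add_two (n : ℕ) :
    polyG (n + 2) =
      C (evenEval π (∑ p ∈ Finset.HasAntidiagonal.antidiagonal (n + 2),
        X * polyG p.1 * polyG p.2)) -
        ∑ p ∈ Finset.HasAntidiagonal.antidiagonal (n + 2), X * polyG p.1 * polyG p.2 := by
  have : ∀ n, Fintype {τ : BinTree // τ.leaves = n} := fun n => Fintype.ofFinite _
  have h : ∑ p ∈ Finset.HasAntidiagonal.antidiagonal (n + 2), X * polyG p.1 * polyG p.2 =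
      ∑ x : Σ p : Finset.HasAntidiagonal.antidiagonal (n + 2),
        {l : BinTree // l.leaves = p.1.1} × {r : BinTree // r.leaves = p.1.2},
        X * x.2.1.1.poly * x.2.2.1.poly := by
    rw [Fintype.sum_sigma, ← Finset.sum_coe_sort]
    refine Finset.sum_congr rfl fun p _ => ?_
    rw [polyG, polyG, finsum_eq_sum_of_fintype, finsum_eq_sum_of_fintype, mul_assoc,
      Finset.sum_mul_sum, ← Fintype.sum_prod_type', Finset.mul_sum]
    simp only [mul_assoc]
  rw [h, map_sum, map_sum, ← Finset.sum_sub_distrib, polyG, finsum_eq_sum_of_fintype]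
  refine Fintype.sum_equiv (BinTree.splitEquiv n) _ _ fun τ => ?_
  obtain ⟨_ | ⟨l, r⟩, h⟩ := τ
  · simp [BinTree.leaves] at h
  · rfl

end Trees

section Formal

open PowerSeries

lemma coeff_polyG_succ (n k : ℕ) :
    (polyG n).coeff (k + 1) =
      -∑ p ∈ Finset.HasAntidiagonal.antidiagonal n, (polyG p.1 * polyG p.2).coeff k := by
  match n with
  | 0 => simp [polyG_zero]
  | 1 => simp [polyG_zero, polyG_one, Finset.Nat.antidiagonal_succ, Polynomial.coeff_one]
  | n + 2 =>
    rw [polyG_add_two, Polynomial.coeff_sub, Polynomial.coeff_C_succ, zero_sub,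
      Polynomial.finsetSum_coeff]
    simp only [mul_assoc, Polynomial.coeff_X_mul]

/-- The generating series over `n` of the coefficients of index `k` of `polyG n`. -/
noncomputable def coeffSeries (k : ℕ) : ℝ⟦X⟧ := PowerSeries.mk fun n => (polyG n).coeff k

lemma coeffSeries_succ (k : ℕ) :
    coeffSeries (k + 1) =
      -∑ p ∈ Finset.HasAntidiagonal.antidiagonal k, coeffSeries p.1 * coeffSeries p.2 := by
  ext n
  simp only [map_neg, map_sum, coeffSeries, coeff_mk, coeff_polyG_succ, PowerSeries.coeff_mul,
    Polynomial.coeff_mul]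
  rw [Finset.sum_comm]

lemma coeffSeries_eq (k : ℕ) :
    coeffSeries k = ((-1 : ℝ) ^ k * catalan k) • coeffSeries 0 ^ (k + 1) := by
  induction k using Nat.strong_induction_on with
  | _ k ih =>
    match k, ih with
    | 0, _ => simp
    | k + 1, ih =>
      rw [coeffSeries_succ, catalan_succ', Nat.cast_sum, Finset.mul_sum, Finset.sum_smul,
        ← Finset.sum_neg_distrib]
      refine Finset.sum_congr rfl fun p hp => ?_
      have hp' := Finset.HasAntidiagonal.mem_antidiagonal.1 hp
      rw [ih p.1 (by omega), ih p.2 (by omega), smul_mul_smul_comm, ← pow_add, ← neg_smul,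
        ← hp']
      congr 1
      · push_cast
        ring
      · congr 1
        ring

lemma coeff_pow_of_lt {A : ℝ⟦X⟧} (hA : constantCoeff A = 0) {n d : ℕ} (h : n < d) :
    coeff n (A ^ d) = 0 :=
  X_pow_dvd_iff.1 (pow_dvd_pow_of_dvd (X_dvd_iff.2 hA) d) n h

lemma constantCoeff_coeffSeries_zero : constantCoeff (coeffSeries 0) = 0 := by
  rw [← coeff_zero_eq_constantCoeff_apply, coeffSeries, coeff_mk, polyG_zero,
    Polynomial.coeff_zero]

lemma catalan_div_factorial (k : ℕ) :
    (catalan k : ℝ) / (2 * k).factorial = 1 / (k.factorial * (k + 1).factorial) := by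
  have h1 := succ_mul_catalan_eq_centralBinom k
  have h2 : k.centralBinom * k.factorial * k.factorial = (2 * k).factorial := by
    have := Nat.choose_mul_factorial_mul_factorial (n := 2 * k) (k := k) (by omega)
    rwa [show 2 * k - k = k by omega] at this
  rw [← h1] at h2
  have h3 : (((k : ℝ) + 1) * catalan k) * k.factorial * k.factorial = (2 * k).factorial := by
    exact_mod_cast h2
  rw [div_eq_div_iff (by positivity) (by positivity), ← h3, Nat.factorial_succ]
  push_cast
  ring

lemma evenEval_polyG (θ : ℝ) (n : ℕ) :
    evenEval θ (polyG n) = ∑ k ∈ Finset.range n,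
      (-1) ^ k * θ ^ (2 * k) / (k.factorial * (k + 1).factorial) *
        coeff n (coeffSeries 0 ^ (k + 1)) := by
  have hc : ∀ k, (polyG n).coeff k =
      (-1) ^ k * catalan k * coeff n (coeffSeries 0 ^ (k + 1)) := by
    intro k
    have := congrArg (coeff n) (coeffSeries_eq k)
    rwa [coeffSeries, coeff_mk, coeff_smul, smul_eq_mul] at this
  have hs : polyG n = ∑ k ∈ Finset.range n, Polynomial.monomial k ((polyG n).coeff k) := by
    refine Polynomial.ext fun d => ?_
    rw [Polynomial.finsetSum_coeff]
    simp only [Polynomial.coeff_monomial, Finset.sum_ite_eq', Finset.mem_range]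
    split_ifs with h
    · rfl
    · rw [hc, coeff_pow_of_lt constantCoeff_coeffSeries_zero (by omega), mul_zero]
  rw [hs, map_sum]
  refine Finset.sum_congr rfl fun k _ => ?_
  rw [evenEval_monomial, hc]
  have := catalan_div_factorial k
  calc _ = (-1) ^ k * θ ^ (2 * k) * coeff n (coeffSeries 0 ^ (k + 1)) *
        ((catalan k : ℝ) / (2 * k).factorial) := by ring
    _ = _ := by rw [this]; ring

lemma evenEval_pi_polyG (n : ℕ) : evenEval π (polyG n) = if n = 1 then 1 else 0 := by
  match n with
  | 0 => simp [polyG_zero]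
  | 1 => simpa [polyG_one] using evenEval_C π 1
  | n + 2 => rw [polyG_add_two, map_sub, evenEval_C, sub_self, if_neg (by omega)]

/-- The series `∑ₖ (-c)^k X^(k+1) / (k! (k+1)!)`. -/
noncomputable def besselSeries (c : ℝ) : ℝ⟦X⟧ :=
  X * PowerSeries.mk fun k => (-c) ^ k / (k.factorial * (k + 1).factorial)

lemma constantCoeff_besselSeries (c : ℝ) : constantCoeff (besselSeries c) = 0 := by
  simp [besselSeries]

/-- The normalized generating series of `G n 0`. -/
noncomputable def rescaledSeries : ℝ⟦X⟧ := π ^ 2 • rescale (π ^ 2)⁻¹ (coeffSeries 0)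

lemma constantCoeff_rescaledSeries : constantCoeff rescaledSeries = 0 := by
  rw [← coeff_zero_eq_constantCoeff_apply, rescaledSeries, coeff_smul, coeff_rescale,
    coeff_zero_eq_constantCoeff_apply, constantCoeff_coeffSeries_zero, mul_zero, smul_zero]

lemma coeff_subst_eq_sum {A : ℝ⟦X⟧} (hA : constantCoeff A = 0) (f : ℝ⟦X⟧) (n : ℕ) :
    coeff n (f.subst A) = ∑ d ∈ Finset.range (n + 1), coeff d f * coeff n (A ^ d) := by
  rw [coeff_subst' (HasSubst.of_constantCoeff_zero' hA)]
  refine (finsum_eq_sum_of_support_subset _ ?_).trans rfl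
  intro d hd
  by_contra h
  simp only [Finset.coe_range, Set.mem_Iio, not_lt] at h
  exact hd (by simp [coeff_pow_of_lt hA (show n < d by omega)])

lemma coeff_subst_besselSeries (θ : ℝ) (n : ℕ) :
    coeff n ((besselSeries ((θ / π) ^ 2)).subst rescaledSeries) =
      π ^ 2 / (π ^ 2) ^ n * evenEval θ (polyG n) := by
  have hπ : π ≠ 0 := pi_ne_zero
  rw [coeff_subst_eq_sum constantCoeff_rescaledSeries, Finset.sum_range_succ',
    coeff_zero_eq_constantCoeff_apply, constantCoeff_besselSeries, zero_mul, add_zero,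
    evenEval_polyG, Finset.mul_sum]
  refine Finset.sum_congr rfl fun k _ => ?_
  rw [besselSeries, coeff_succ_X_mul, coeff_mk, rescaledSeries, smul_pow, ← map_pow, coeff_smul,
    coeff_rescale, smul_eq_mul]
  have : (-(θ / π) ^ 2) ^ k = (-1) ^ k * θ ^ (2 * k) / (π ^ 2) ^ k := by
    rw [neg_pow, div_pow, div_pow, pow_mul]
    ring
  rw [this, inv_pow, pow_succ (π ^ 2) k]
  field_simp

lemma subst_rescaledSeries : (besselSeries 1).subst rescaledSeries = X := by
  ext n
  have := coeff_subst_besselSeries π n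
  rw [div_self pi_ne_zero, one_pow, evenEval_pi_polyG] at this
  rw [this, coeff_X]
  split_ifs with h
  · rw [h, pow_one, div_self (by positivity), mul_one]
  · rw [mul_zero]

lemma X_pow_dvd_besselSeries_sub (θ : ℝ) (N : ℕ) :
    X ^ (N + 1) ∣ besselSeries ((θ / π) ^ 2) - ∑ j ∈ Finset.range (N + 1),
      C (π ^ 2 / (π ^ 2) ^ j * evenEval θ (polyG j)) * besselSeries 1 ^ j := by
  have hY : HasSubst rescaledSeries := HasSubst.of_constantCoeff_zero' constantCoeff_rescaledSeries
  have hs0 := constantCoeff_besselSeries 1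
  have hs : HasSubst (besselSeries 1) := HasSubst.of_constantCoeff_zero' hs0
  have h1 : IsUnit (coeff 1 (besselSeries 1)) := by simp [besselSeries]
  have hinv : rescaledSeries = substInvOfIsUnit (besselSeries 1) h1 := by
    have h := congrArg (fun f : ℝ⟦X⟧ => PowerSeries.subst rescaledSeries f)
      (subst_substInvOfIsUnit_left (besselSeries 1) hs0 h1)
    rw [subst_comp_subst_apply hs hY, subst_rescaledSeries, subst_X hY] at h
    rw [X_subst] at h
    exact h.symm
  have hleft : rescaledSeries.subst (besselSeries 1) = X := by
    rw [hinv, subst_substInvOfIsUnit_left _ hs0]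
  have hh : besselSeries ((θ / π) ^ 2) =
      PowerSeries.subst (besselSeries 1)
        (PowerSeries.subst rescaledSeries (besselSeries ((θ / π) ^ 2))) := by
    rw [subst_comp_subst_apply hY hs, hleft]
    exact (X_subst (besselSeries _)).symm
  rw [X_pow_dvd_iff]
  intro m hm
  rw [map_sub, sub_eq_zero, map_sum]
  conv_lhs => rw [hh]
  rw [coeff_subst_eq_sum hs0]
  simp only [coeff_subst_besselSeries, coeff_C_mul]
  refine Finset.sum_subset (Finset.range_mono (by omega)) fun j _ hj => ?_
  rw [coeff_pow_of_lt hs0 (by simpa using hj), mul_zero]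

end Formal

section PowerSeriesSums

open PowerSeries

/-- The power series `P` converges at every complex number of norm less than `ρ`. -/
def ConvOn (P : ℝ⟦X⟧) (ρ : ℝ) : Prop :=
  ∀ z : ℂ, ‖z‖ < ρ → Summable fun k => ((coeff k P : ℝ) : ℂ) * z ^ k

/-- The sum of a power series at a complex number. -/
noncomputable def psum (P : ℝ⟦X⟧) (z : ℂ) : ℂ := ∑' k, ((coeff k P : ℝ) : ℂ) * z ^ k

variable {P Q : ℝ⟦X⟧} {ρ : ℝ}

lemma ConvOn.hasSum (hP : ConvOn P ρ) {z : ℂ} (hz : ‖z‖ < ρ) :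
    HasSum (fun k => ((coeff k P : ℝ) : ℂ) * z ^ k) (psum P z) := (hP z hz).hasSum

lemma mul_term_eq (z : ℂ) (n : ℕ) :
    ((coeff n (P * Q) : ℝ) : ℂ) * z ^ n = ∑ p ∈ Finset.HasAntidiagonal.antidiagonal n,
      (((coeff p.1 P : ℝ) : ℂ) * z ^ p.1) * (((coeff p.2 Q : ℝ) : ℂ) * z ^ p.2) := by
  rw [PowerSeries.coeff_mul, Complex.ofReal_sum, Finset.sum_mul]
  refine Finset.sum_congr rfl fun p hp => ?_
  rw [← Finset.HasAntidiagonal.mem_antidiagonal.1 hp, pow_add]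
  push_cast
  ring

lemma ConvOn.mul (hP : ConvOn P ρ) (hQ : ConvOn Q ρ) : ConvOn (P * Q) ρ := fun z hz => by
  simp only [mul_term_eq]
  exact (summable_norm_sum_mul_antidiagonal_of_summable_norm (hP z hz).norm (hQ z hz).norm).of_norm

lemma psum_mul (hP : ConvOn P ρ) (hQ : ConvOn Q ρ) {z : ℂ} (hz : ‖z‖ < ρ) :
    psum (P * Q) z = psum P z * psum Q z := by
  simp only [psum, mul_term_eq]
  exact (tsum_mul_tsum_eq_tsum_sum_antidiagonal_of_summable_norm
    (hP z hz).norm (hQ z hz).norm).symm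

lemma ConvOn.sub (hP : ConvOn P ρ) (hQ : ConvOn Q ρ) : ConvOn (P - Q) ρ := fun z hz => by
  simpa [sub_mul] using (hP z hz).sub (hQ z hz)

lemma psum_sub (hP : ConvOn P ρ) (hQ : ConvOn Q ρ) {z : ℂ} (hz : ‖z‖ < ρ) :
    psum (P - Q) z = psum P z - psum Q z := by
  simpa [psum, sub_mul] using (hP z hz).tsum_sub (hQ z hz)

lemma psum_neg (z : ℂ) : psum (-P) z = -psum P z := by
  simp [psum, tsum_neg]

lemma ConvOn.add (hP : ConvOn P ρ) (hQ : ConvOn Q ρ) : ConvOn (P + Q) ρ := fun z hz => by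
  simpa [add_mul] using (hP z hz).add (hQ z hz)

lemma psum_add (hP : ConvOn P ρ) (hQ : ConvOn Q ρ) {z : ℂ} (hz : ‖z‖ < ρ) :
    psum (P + Q) z = psum P z + psum Q z := by
  simpa [psum, add_mul] using (hP z hz).tsum_add (hQ z hz)

lemma hasSum_C (a : ℝ) (z : ℂ) : HasSum (fun k => ((coeff k (C a) : ℝ) : ℂ) * z ^ k) a := by
  have h := hasSum_single (f := fun k => ((coeff k (C a) : ℝ) : ℂ) * z ^ k) 0
    (fun k hk => by simp [coeff_C, hk])
  simpa using h

lemma hasSum_X (z : ℂ) : HasSum (fun k => ((coeff k (X : ℝ⟦X⟧) : ℝ) : ℂ) * z ^ k) z := by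
  have h := hasSum_single (f := fun k => ((coeff k (X : ℝ⟦X⟧) : ℝ) : ℂ) * z ^ k) 1
    (fun k hk => by simp [coeff_X, hk])
  simpa using h

lemma convOn_C (a ρ : ℝ) : ConvOn (C a) ρ := fun z _ => (hasSum_C a z).summable

lemma convOn_X (ρ : ℝ) : ConvOn X ρ := fun z _ => (hasSum_X z).summable

lemma psum_C (a : ℝ) (z : ℂ) : psum (C a) z = a := (hasSum_C a z).tsum_eq

lemma psum_X (z : ℂ) : psum X z = z := (hasSum_X z).tsum_eq

lemma ConvOn.pow (hP : ConvOn P ρ) (n : ℕ) : ConvOn (P ^ n) ρ := by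
  induction n with
  | zero => simpa using convOn_C 1 ρ
  | succ n ih => rw [pow_succ]; exact ih.mul hP

lemma psum_pow (hP : ConvOn P ρ) (n : ℕ) {z : ℂ} (hz : ‖z‖ < ρ) :
    psum (P ^ n) z = psum P z ^ n := by
  induction n with
  | zero => simpa using psum_C 1 z
  | succ n ih => rw [pow_succ, psum_mul (hP.pow n) hP hz, ih, pow_succ]

lemma convOn_sum {ι : Type*} (s : Finset ι) {P : ι → ℝ⟦X⟧} (hP : ∀ i, ConvOn (P i) ρ) :
    ConvOn (∑ i ∈ s, P i) ρ := by
  classical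
  induction s using Finset.induction_on with
  | empty => simpa using convOn_C 0 ρ
  | insert i s hi ih => rw [Finset.sum_insert hi]; exact (hP i).add ih

lemma psum_sum {ι : Type*} (s : Finset ι) {P : ι → ℝ⟦X⟧} (hP : ∀ i, ConvOn (P i) ρ) {z : ℂ}
    (hz : ‖z‖ < ρ) : psum (∑ i ∈ s, P i) z = ∑ i ∈ s, psum (P i) z := by
  classical
  induction s using Finset.induction_on with
  | empty => simpa using psum_C 0 z
  | insert i s hi ih =>
    rw [Finset.sum_insert hi, psum_add (hP i) (convOn_sum s hP) hz, ih, Finset.sum_insert hi]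

lemma ConvOn.of_X_pow_mul {N : ℕ} (h : ConvOn (X ^ N * Q) ρ) : ConvOn Q ρ := fun z hz => by
  rcases eq_or_ne z 0 with rfl | hz0
  · exact summable_of_ne_finset_zero (s := {0}) fun k hk => by
      simp [show k ≠ 0 by simpa using hk]
  · have h1 := ((summable_nat_add_iff N).2 (h z hz)).mul_left (z ^ N)⁻¹
    refine h1.congr fun k => ?_
    rw [coeff_X_pow_mul, pow_add]
    field_simp

lemma psum_zero_right (P : ℝ⟦X⟧) : psum P 0 = constantCoeff P := by
  have h := hasSum_single (f := fun k => ((coeff k P : ℝ) : ℂ) * 0 ^ k) 0 (fun k hk => by simp [hk])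
  rw [psum, h.tsum_eq]
  simp

lemma ConvOn.hasSum_deriv (hP : ConvOn P ρ) {z : ℂ} (hz : ‖z‖ < ρ) :
    DifferentiableAt ℂ (psum P) z ∧
      HasSum (fun k => ((coeff k (d⁄dX ℝ P) : ℝ) : ℂ) * z ^ k) (deriv (psum P) z) := by
  obtain ⟨r, hzr, hrρ⟩ := exists_between hz
  have hr0 : 0 < r := (norm_nonneg z).trans_lt hzr
  have hu : Summable fun k => ‖((coeff k P : ℝ) : ℂ) * (r : ℂ) ^ k‖ :=
    (hP r (by rwa [Complex.norm_real, Real.norm_of_nonneg hr0.le])).norm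
  have hf : ∀ k : ℕ, DifferentiableOn ℂ (fun w : ℂ => ((coeff k P : ℝ) : ℂ) * w ^ k)
      (Metric.ball 0 r) := fun k => by fun_prop
  have hle : ∀ (k : ℕ) (w : ℂ), w ∈ Metric.ball (0 : ℂ) r →
      ‖((coeff k P : ℝ) : ℂ) * w ^ k‖ ≤ ‖((coeff k P : ℝ) : ℂ) * (r : ℂ) ^ k‖ := by
    intro k w hw
    rw [norm_mul, norm_mul, norm_pow, norm_pow, Complex.norm_real r, Real.norm_of_nonneg hr0.le]
    have := (mem_ball_zero_iff.1 hw).le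
    gcongr
  have hzb : z ∈ Metric.ball (0 : ℂ) r := mem_ball_zero_iff.2 hzr
  refine ⟨(Complex.differentiableOn_tsum_of_summable_norm hu hf Metric.isOpen_ball
    hle).differentiableAt (Metric.isOpen_ball.mem_nhds hzb), ?_⟩
  have h := Complex.hasSum_deriv_of_summable_norm hu hf Metric.isOpen_ball hle hzb
  rw [← hasSum_nat_add_iff' 1] at h
  simp only [Finset.range_one, Finset.sum_singleton, pow_zero, mul_one, deriv_const,
    sub_zero] at h
  refine h.congr_fun fun k => ?_
  simp [coeff_derivative]
  ring

lemma ConvOn.derivative (hP : ConvOn P ρ) : ConvOn (d⁄dX ℝ P) ρ :=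
  fun _ hz => (hP.hasSum_deriv hz).2.summable

lemma ConvOn.hasDerivAt (hP : ConvOn P ρ) {z : ℂ} (hz : ‖z‖ < ρ) :
    HasDerivAt (psum P) (psum (d⁄dX ℝ P) z) z := by
  have h := hP.hasSum_deriv hz
  rw [psum, h.2.tsum_eq]
  exact h.1.hasDerivAt

lemma ConvOn.differentiableOn (hP : ConvOn P ρ) :
    DifferentiableOn ℂ (psum P) (Metric.ball 0 ρ) := fun _ hz =>
  (hP.hasDerivAt (mem_ball_zero_iff.1 hz)).differentiableAt.differentiableWithinAt

lemma convOn_of_abs_coeff_le {C ρ : ℝ} (h : ∀ k, |coeff k P| ≤ C * (ρ⁻¹) ^ k) (hρ : 0 < ρ) :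
    ConvOn P ρ := fun z hz => by
  have hq : ‖z‖ / ρ < 1 := (div_lt_one hρ).2 hz
  refine Summable.of_norm_bounded
    ((summable_geometric_of_lt_one (by positivity) hq).mul_left C) fun k => ?_
  rw [norm_mul, norm_pow, Complex.norm_real, Real.norm_eq_abs, div_pow]
  calc |coeff k P| * ‖z‖ ^ k ≤ (C * (ρ⁻¹) ^ k) * ‖z‖ ^ k := by gcongr; exact h k
    _ = _ := by rw [inv_pow]; ring

lemma convOn_of_abs_coeff_le_factorial {c : ℝ} (h : ∀ k, |coeff k P| ≤ c ^ k / k.factorial)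
    (ρ : ℝ) : ConvOn P ρ := fun z _ => by
  refine Summable.of_norm_bounded (Real.summable_pow_div_factorial (c * ‖z‖)) fun k => ?_
  rw [norm_mul, norm_pow, Complex.norm_real, Real.norm_eq_abs, mul_pow]
  calc |coeff k P| * ‖z‖ ^ k ≤ (c ^ k / k.factorial) * ‖z‖ ^ k := by gcongr; exact h k
    _ = _ := by ring

lemma psum_ofReal (P : ℝ⟦X⟧) (x : ℝ) : psum P x = ((∑' k, coeff k P * x ^ k : ℝ) : ℂ) := by
  rw [psum, Complex.ofReal_tsum]
  push_cast
  rfl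

end PowerSeriesSums

section Kernel

open PowerSeries

/-- The series `∑ₖ (-1)^k X^k / (k! (k+1)!)`. -/
noncomputable def kernelSeries : ℝ⟦X⟧ :=
  PowerSeries.mk fun k => (-1) ^ k / (k.factorial * (k + 1).factorial)

/-- The series `∑ₖ (-c)^k X^k / (k!)²`. -/
noncomputable def bessel0Series (c : ℝ) : ℝ⟦X⟧ :=
  PowerSeries.mk fun k => (-c) ^ k / (k.factorial : ℝ) ^ 2

lemma besselSeries_one : besselSeries 1 = X * kernelSeries := rfl

lemma derivative_besselSeries (c : ℝ) : d⁄dX ℝ (besselSeries c) = bessel0Series c := by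
  ext n
  rw [coeff_derivative, besselSeries, coeff_succ_X_mul, coeff_mk, bessel0Series, coeff_mk,
    Nat.factorial_succ]
  push_cast
  field_simp

lemma derivative_bessel0Series_one : d⁄dX ℝ (bessel0Series 1) = -kernelSeries := by
  ext n
  rw [coeff_derivative, map_neg, bessel0Series, coeff_mk, kernelSeries, coeff_mk,
    Nat.factorial_succ]
  push_cast
  field_simp
  ring

lemma constantCoeff_kernelSeries : constantCoeff kernelSeries = 1 := by
  rw [← coeff_zero_eq_constantCoeff_apply, kernelSeries, coeff_mk]
  simp

/-- Minus the logarithmic derivative of `kernelSeries`. -/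
noncomputable def logDerivSeries : ℝ⟦X⟧ := -(d⁄dX ℝ kernelSeries) * kernelSeries⁻¹

lemma derivative_kernelSeries : d⁄dX ℝ kernelSeries = -(logDerivSeries * kernelSeries) := by
  rw [logDerivSeries, mul_assoc, PowerSeries.inv_mul_cancel]
  · ring
  · simp [constantCoeff_kernelSeries]

lemma bessel0Series_one : bessel0Series 1 = kernelSeries * (1 - X * logDerivSeries) := by
  rw [← derivative_besselSeries, besselSeries_one, Derivation.leibniz, derivative_kernelSeries,
    derivative_X]
  simp only [smul_eq_mul]
  ring

lemma logDerivSeries_riccati :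
    X * d⁄dX ℝ logDerivSeries + 2 * logDerivSeries = 1 + X * logDerivSeries ^ 2 := by
  have hA : kernelSeries ≠ 0 := fun h => by
    simpa [h] using constantCoeff_kernelSeries
  have h := derivative_bessel0Series_one
  rw [bessel0Series_one, Derivation.leibniz, derivative_kernelSeries, map_sub,
    Derivation.leibniz, derivative_X, derivative_one] at h
  simp only [smul_eq_mul] at h
  refine mul_left_cancel₀ hA ?_
  linear_combination -h

lemma coeff_zero_logDerivSeries : coeff 0 logDerivSeries = 1 / 2 := by
  have h := congrArg constantCoeff logDerivSeries_riccati
  simp only [map_add, map_mul, constantCoeff_X, zero_mul, map_one, zero_add, add_zero,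
    map_ofNat] at h
  rw [coeff_zero_eq_constantCoeff_apply]
  linarith

lemma coeff_succ_logDerivSeries (n : ℕ) :
    ((n : ℝ) + 3) * coeff (n + 1) logDerivSeries =
      ∑ p ∈ Finset.HasAntidiagonal.antidiagonal n,
        coeff p.1 logDerivSeries * coeff p.2 logDerivSeries := by
  have h := congrArg (coeff (n + 1)) logDerivSeries_riccati
  rw [two_mul, map_add, map_add, map_add, coeff_succ_X_mul, coeff_succ_X_mul, coeff_derivative,
    pow_two, PowerSeries.coeff_mul, coeff_one, if_neg (by omega), zero_add] at h
  rw [← h]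
  ring

lemma coeff_logDerivSeries_bounds (n : ℕ) :
    0 ≤ coeff n logDerivSeries ∧ coeff n logDerivSeries ≤ (1 / 2) ^ (n + 1) := by
  induction n using Nat.strong_induction_on with
  | _ n ih =>
    match n, ih with
    | 0, _ => rw [coeff_zero_logDerivSeries]; norm_num
    | n + 1, ih =>
      have h := coeff_succ_logDerivSeries n
      have hlt : ∀ p ∈ Finset.HasAntidiagonal.antidiagonal n, p.1 < n + 1 ∧ p.2 < n + 1 :=
        fun p hp => by
          have := Finset.HasAntidiagonal.mem_antidiagonal.1 hp
          omega
      have h0 : 0 ≤ ((n : ℝ) + 3) * coeff (n + 1) logDerivSeries := by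
        rw [h]
        exact Finset.sum_nonneg fun p hp =>
          mul_nonneg (ih _ (hlt p hp).1).1 (ih _ (hlt p hp).2).1
      have h1 : ((n : ℝ) + 3) * coeff (n + 1) logDerivSeries ≤
          ((n : ℝ) + 1) * (1 / 2) ^ (n + 2) := by
        rw [h]
        calc _ ≤ ∑ p ∈ Finset.HasAntidiagonal.antidiagonal n, (1 / 2 : ℝ) ^ (n + 2) := by
              refine Finset.sum_le_sum fun p hp => ?_
              have hs := Finset.HasAntidiagonal.mem_antidiagonal.1 hp
              rw [← hs, show p.1 + p.2 + 2 = (p.1 + 1) + (p.2 + 1) by ring, pow_add]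
              exact mul_le_mul (ih _ (hlt p hp).1).2 (ih _ (hlt p hp).2).2
                (ih _ (hlt p hp).2).1 (by positivity)
          _ = _ := by
              rw [Finset.sum_const, Finset.Nat.card_antidiagonal, nsmul_eq_mul]
              push_cast
              ring
      have hn : (0 : ℝ) < (n : ℝ) + 3 := by positivity
      refine ⟨nonneg_of_mul_nonneg_right h0 hn, le_of_mul_le_mul_left (h1.trans ?_) hn⟩
      gcongr
      · norm_num

/-- The primitive of `logDerivSeries` with zero constant coefficient. -/
noncomputable def logKernelSeries : ℝ⟦X⟧ :=
  X * PowerSeries.mk fun k => coeff k logDerivSeries / (k + 1)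

lemma derivative_logKernelSeries : d⁄dX ℝ logKernelSeries = logDerivSeries := by
  ext n
  rw [coeff_derivative, logKernelSeries, coeff_succ_X_mul, coeff_mk]
  field_simp

lemma coeff_logKernelSeries_nonneg (n : ℕ) : 0 ≤ coeff n logKernelSeries := by
  rw [logKernelSeries]
  cases n with
  | zero => simp
  | succ n =>
    rw [coeff_succ_X_mul, coeff_mk]
    exact div_nonneg (coeff_logDerivSeries_bounds n).1 (by positivity)

lemma coeff_one_logKernelSeries : coeff 1 logKernelSeries = 1 / 2 := by
  have h := coeff_succ_X_mul 0 (PowerSeries.mk fun k => coeff k logDerivSeries / ((k : ℝ) + 1))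
  rw [coeff_mk, coeff_zero_logDerivSeries, zero_add] at h
  rw [logKernelSeries, h]
  norm_num

lemma convOn_logDerivSeries : ConvOn logDerivSeries 2 := by
  refine convOn_of_abs_coeff_le (C := 1 / 2) (fun k => ?_) two_pos
  rw [abs_of_nonneg (coeff_logDerivSeries_bounds k).1]
  refine (coeff_logDerivSeries_bounds k).2.trans_eq ?_
  rw [pow_succ]
  norm_num
  ring

lemma convOn_logKernelSeries : ConvOn logKernelSeries 2 := by
  refine (convOn_X 2).mul (convOn_of_abs_coeff_le (C := 1 / 2) (fun k => ?_) two_pos)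
  rw [coeff_mk, abs_of_nonneg (div_nonneg (coeff_logDerivSeries_bounds k).1 (by positivity))]
  refine (div_le_self (coeff_logDerivSeries_bounds k).1 (by simp)).trans
    ((coeff_logDerivSeries_bounds k).2.trans_eq ?_)
  rw [pow_succ]
  norm_num
  ring

lemma convOn_mk_div_factorial (c ρ : ℝ) : ConvOn
    (PowerSeries.mk fun k => (-c) ^ k / ((k.factorial : ℝ) * (k + 1).factorial)) ρ := by
  refine convOn_of_abs_coeff_le_factorial (c := |c|) (fun k => ?_) ρ
  rw [coeff_mk, abs_div, abs_pow, abs_neg, abs_of_nonneg (by positivity : (0 : ℝ) ≤ _ * _)]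
  gcongr
  exact le_mul_of_one_le_right (by positivity)
    (mod_cast Nat.one_le_iff_ne_zero.2 (Nat.factorial_ne_zero _))

lemma convOn_kernelSeries (ρ : ℝ) : ConvOn kernelSeries ρ := convOn_mk_div_factorial 1 ρ

lemma convOn_besselSeries (c ρ : ℝ) : ConvOn (besselSeries c) ρ :=
  (convOn_X ρ).mul (convOn_mk_div_factorial c ρ)

lemma convOn_bessel0Series (c ρ : ℝ) : ConvOn (bessel0Series c) ρ :=
  derivative_besselSeries c ▸ (convOn_besselSeries c ρ).derivative

lemma psum_kernelSeries {z : ℂ} (hz : ‖z‖ < 2) :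
    psum kernelSeries z = Complex.exp (-psum logKernelSeries z) := by
  have hd : ∀ w ∈ Metric.ball (0 : ℂ) 2, HasDerivAt
      (fun w => psum kernelSeries w * Complex.exp (psum logKernelSeries w)) 0 w := by
    intro w hw
    have hw' := mem_ball_zero_iff.1 hw
    have h1 := (convOn_kernelSeries 2).hasDerivAt hw'
    have h2 := (convOn_logKernelSeries.hasDerivAt hw').cexp
    rw [derivative_logKernelSeries] at h2
    rw [derivative_kernelSeries, psum_neg,
      psum_mul convOn_logDerivSeries (convOn_kernelSeries 2) hw'] at h1
    refine (h1.mul h2).congr_deriv ?_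
    ring
  have hc := (Metric.isOpen_ball (x := (0 : ℂ)) (ε := 2)).is_const_of_deriv_eq_zero
    (convex_ball (0 : ℂ) 2).isPreconnected
    (fun w hw => (hd w hw).differentiableAt.differentiableWithinAt)
    (fun w hw => (hd w hw).deriv) (mem_ball_zero_iff.2 hz) (Metric.mem_ball_self two_pos)
  rw [psum_zero_right, psum_zero_right, constantCoeff_kernelSeries] at hc
  have h0 : constantCoeff logKernelSeries = 0 := by simp [logKernelSeries]
  rw [h0] at hc
  simp only [Complex.ofReal_zero, Complex.exp_zero, Complex.ofReal_one, mul_one] at hc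
  rw [Complex.exp_neg, eq_inv_of_mul_eq_one_left hc]

lemma psum_kernelSeries_ne_zero {z : ℂ} (hz : ‖z‖ < 2) : psum kernelSeries z ≠ 0 := by
  rw [psum_kernelSeries hz]
  exact Complex.exp_ne_zero _

lemma re_psum_logKernelSeries_sub_le {r : ℝ} (h0 : 0 ≤ r) (h2 : r < 2) (t : ℝ) :
    r / 2 * (1 - cos t) ≤ (psum logKernelSeries r).re -
      (psum logKernelSeries (r * Complex.exp (t * Complex.I))).re := by
  have hn1 : ‖(r : ℂ)‖ < 2 := by rwa [Complex.norm_real, Real.norm_of_nonneg h0]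
  have hn2 : ‖(r : ℂ) * Complex.exp (t * Complex.I)‖ < 2 := by
    rwa [norm_mul, Complex.norm_exp_ofReal_mul_I, mul_one]
  have hs := (Complex.hasSum_re (convOn_logKernelSeries.hasSum hn1)).sub
    (Complex.hasSum_re (convOn_logKernelSeries.hasSum hn2))
  have hterm : ∀ k : ℕ, (((coeff k logKernelSeries : ℝ) : ℂ) * (r : ℂ) ^ k).re -
      (((coeff k logKernelSeries : ℝ) : ℂ) * ((r : ℂ) * Complex.exp (t * Complex.I)) ^ k).re =
      coeff k logKernelSeries * r ^ k * (1 - cos (k * t)) := by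
    intro k
    have : Complex.exp (t * Complex.I) ^ k = Complex.exp ((k * t : ℝ) * Complex.I) := by
      rw [← Complex.exp_nat_mul]
      push_cast
      ring_nf
    rw [mul_pow, this, ← mul_assoc, ← Complex.ofReal_pow, ← Complex.ofReal_mul,
      Complex.re_ofReal_mul, Complex.exp_ofReal_mul_I_re, Complex.ofReal_re]
    ring
  simp only [hterm] at hs
  have hle := hs.summable.le_tsum 1 fun k _ => mul_nonneg
    (mul_nonneg (coeff_logKernelSeries_nonneg k) (pow_nonneg h0 k))
    (by linarith [cos_le_one (k * t)])
  rw [hs.tsum_eq, coeff_one_logKernelSeries] at hle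
  refine le_of_eq_of_le ?_ hle
  push_cast
  ring_nf

lemma norm_psum_kernelSeries_div_le {r : ℝ} (h0 : 0 ≤ r) (h2 : r < 2) {t : ℝ} (ht : |t| ≤ π) :
    ‖psum kernelSeries r / psum kernelSeries (r * Complex.exp (t * Complex.I))‖ ≤
      Real.exp (-(r / π ^ 2 * t ^ 2)) := by
  have hn1 : ‖(r : ℂ)‖ < 2 := by rwa [Complex.norm_real, Real.norm_of_nonneg h0]
  have hn2 : ‖(r : ℂ) * Complex.exp (t * Complex.I)‖ < 2 := by
    rwa [norm_mul, Complex.norm_exp_ofReal_mul_I, mul_one]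
  rw [psum_kernelSeries hn1, psum_kernelSeries hn2, ← Complex.exp_sub, Complex.norm_exp]
  refine Real.exp_le_exp.2 ?_
  have h := re_psum_logKernelSeries_sub_le h0 h2 t
  have hc := cos_le_one_sub_mul_cos_sq ht
  have h3 : r / 2 * (2 / π ^ 2 * t ^ 2) ≤ r / 2 * (1 - cos t) := by
    gcongr
    linarith
  have h4 : r / 2 * (2 / π ^ 2 * t ^ 2) = r / π ^ 2 * t ^ 2 := by ring
  simp only [Complex.sub_re, Complex.neg_re]
  linarith

end Kernel

section BesselZero

open PowerSeries

lemma psum_bessel0Series_sq (a x : ℝ) :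
    psum (bessel0Series (a ^ 2)) ((x ^ 2 / 4 : ℝ) : ℂ) = (J0 (a * x) : ℂ) := by
  rw [psum_ofReal, J0]
  congr 2
  ext k
  rw [bessel0Series, coeff_mk, neg_pow, div_mul_eq_mul_div, mul_assoc, ← mul_pow, pow_mul]
  congr 3
  ring

lemma J1_eq (x : ℝ) : (J1 x : ℂ) = x / 2 * psum kernelSeries ((x ^ 2 / 4 : ℝ) : ℂ) := by
  rw [psum_ofReal, J1]
  rw [show (x : ℂ) / 2 = ((x / 2 : ℝ) : ℂ) by push_cast; rfl, ← Complex.ofReal_mul, ← tsum_mul_left]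
  congr 2
  ext k
  rw [kernelSeries, coeff_mk, pow_succ, pow_mul, show (x / 2) ^ 2 = x ^ 2 / 4 by ring]
  ring

lemma J0_eq_re (x : ℝ) : J0 x = (psum (bessel0Series 1) ((x ^ 2 / 4 : ℝ) : ℂ)).re := by
  have h := psum_bessel0Series_sq 1 x
  rw [one_pow, one_mul] at h
  rw [h, Complex.ofReal_re]

lemma continuous_J0 : Continuous J0 := by
  have h : Continuous (psum (bessel0Series 1)) := continuous_iff_continuousAt.2 fun z =>
    ((convOn_bessel0Series 1 (‖z‖ + 1)).hasDerivAt (lt_add_one _)).continuousAt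
  rw [show J0 = _ from funext J0_eq_re]
  fun_prop

lemma J0_zero : J0 0 = 1 := by
  rw [J0_eq_re, show ((0 : ℝ) ^ 2 / 4 : ℝ) = 0 by norm_num, Complex.ofReal_zero, psum_zero_right,
    ← coeff_zero_eq_constantCoeff_apply, bessel0Series, coeff_mk]
  simp

lemma two_thirds_lt_logDeriv :
    2 / 3 < ∑' k, coeff k logDerivSeries * (3 / 2 : ℝ) ^ k := by
  have h1 : coeff 1 logDerivSeries = 1 / 12 := by
    have h := coeff_succ_logDerivSeries 0
    simp only [Finset.Nat.antidiagonal_zero, Finset.sum_singleton, coeff_zero_logDerivSeries] at h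
    norm_num at h ⊢
    linarith
  have h2 : coeff 2 logDerivSeries = 1 / 48 := by
    have h := coeff_succ_logDerivSeries 1
    simp only [Finset.Nat.antidiagonal_succ, Finset.Nat.antidiagonal_zero, Finset.map_singleton,
      Finset.sum_cons, Finset.sum_singleton, coeff_zero_logDerivSeries, Function.Embedding.prodMap,
      Function.Embedding.coeFn_mk, Prod.map] at h
    norm_num [h1, coeff_zero_logDerivSeries] at h ⊢
    linarith
  have hs : Summable fun k => coeff k logDerivSeries * (3 / 2 : ℝ) ^ k := by
    have h := convOn_logDerivSeries ((3 / 2 : ℝ) : ℂ)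
      (by rw [Complex.norm_real, Real.norm_of_nonneg] <;> norm_num)
    exact_mod_cast h
  have hle := hs.sum_le_tsum (Finset.range 3) fun k _ =>
    mul_nonneg (coeff_logDerivSeries_bounds k).1 (by positivity)
  refine lt_of_lt_of_le ?_ hle
  simp only [Finset.sum_range_succ, Finset.sum_range_zero, coeff_zero_logDerivSeries, h1, h2]
  norm_num

lemma J0_sqrt_six_neg : J0 (√6) < 0 := by
  have hn : ‖((3 / 2 : ℝ) : ℂ)‖ < 2 := by
    rw [Complex.norm_real, Real.norm_of_nonneg] <;> norm_num
  have hX : ConvOn (X * logDerivSeries) 2 := (convOn_X 2).mul convOn_logDerivSeries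
  have h1 : ConvOn (1 : ℝ⟦X⟧) 2 := by simpa using convOn_C 1 2
  have hp1 : psum 1 ((3 / 2 : ℝ) : ℂ) = 1 := by simpa using psum_C 1 ((3 / 2 : ℝ) : ℂ)
  rw [J0_eq_re, Real.sq_sqrt (by norm_num), show (6 / 4 : ℝ) = 3 / 2 by norm_num, bessel0Series_one,
    psum_mul (convOn_kernelSeries 2) (h1.sub hX) hn, psum_sub h1 hX hn, hp1,
    psum_mul (convOn_X 2) convOn_logDerivSeries hn, psum_X, psum_kernelSeries hn,
    psum_ofReal, psum_ofReal, ← Complex.ofReal_neg, ← Complex.ofReal_exp, ← Complex.ofReal_one,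
    ← Complex.ofReal_mul, ← Complex.ofReal_sub, ← Complex.ofReal_mul, Complex.ofReal_re]
  refine mul_neg_of_pos_of_neg (Real.exp_pos _) ?_
  linarith [two_thirds_lt_logDeriv]

lemma bddBelow_J0_zeros : BddBelow {x : ℝ | 0 < x ∧ J0 x = 0} := ⟨0, fun _ hx => hx.1.le⟩

lemma exists_J0_zero : ∃ x : ℝ, (0 < x ∧ J0 x = 0) ∧ x < √6 := by
  have hmem : (0 : ℝ) ∈ Set.Ioo (J0 (√6)) (J0 0) :=
    ⟨J0_sqrt_six_neg, J0_zero ▸ one_pos⟩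
  obtain ⟨x, hx, h0⟩ := intermediate_value_Ioo' (Real.sqrt_nonneg 6) continuous_J0.continuousOn hmem
  exact ⟨x, ⟨hx.1, h0⟩, hx.2⟩

lemma J0_c0 : J0 c0 = 0 := by
  obtain ⟨x, hx, -⟩ := exists_J0_zero
  exact closure_minimal (t := {y : ℝ | J0 y = 0}) (fun y hy => hy.2)
    (isClosed_singleton.preimage continuous_J0) (csInf_mem_closure ⟨x, hx⟩ bddBelow_J0_zeros)

lemma c0_pos : 0 < c0 := by
  refine lt_of_le_of_ne (Real.sInf_nonneg fun x hx => hx.1.le) fun h => ?_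
  have h0 := J0_c0
  rw [← h, J0_zero] at h0
  exact one_ne_zero h0

lemma c0_lt : c0 < √6 := by
  obtain ⟨x, hx, hlt⟩ := exists_J0_zero
  exact (csInf_le bddBelow_J0_zeros hx).trans_lt hlt

/-- The critical point `c₀²/4`. -/
noncomputable def zc : ℝ := c0 ^ 2 / 4

lemma zc_pos : 0 < zc := by
  have := c0_pos
  unfold zc
  positivity

lemma zc_lt_two : zc < 2 := by
  have h := pow_lt_pow_left₀ c0_lt c0_pos.le two_ne_zero
  rw [Real.sq_sqrt (by norm_num)] at h
  unfold zc
  linarith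

lemma norm_zc_lt : ‖(zc : ℂ)‖ < 2 := by
  rw [Complex.norm_real, Real.norm_of_nonneg zc_pos.le]
  exact zc_lt_two

lemma psum_bessel0Series_zc (θ : ℝ) :
    psum (bessel0Series ((θ / π) ^ 2)) zc = (J0 (θ * c0 / π) : ℂ) := by
  rw [zc, psum_bessel0Series_sq]
  congr 2
  ring

lemma psum_bessel0Series_one_zc : psum (bessel0Series 1) zc = 0 := by
  have h := psum_bessel0Series_sq 1 c0
  rw [one_pow, one_mul, J0_c0, Complex.ofReal_zero] at h
  exact h

lemma psum_besselSeries_zc : psum (besselSeries 1) zc = ((π ^ 2 * xc : ℝ) : ℂ) := by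
  rw [besselSeries_one, psum_mul (convOn_X 2) (convOn_kernelSeries 2) norm_zc_lt, psum_X, xc]
  push_cast
  rw [J1_eq, ← zc, zc]
  push_cast
  have : (π : ℂ) ≠ 0 := Complex.ofReal_ne_zero.2 pi_ne_zero
  field_simp
  ring

end BesselZero

section Contour

open PowerSeries

lemma psum_besselSeries_one {z : ℂ} (hz : ‖z‖ < 2) :
    psum (besselSeries 1) z = z * psum kernelSeries z := by
  rw [besselSeries_one, psum_mul (convOn_X 2) (convOn_kernelSeries 2) hz, psum_X]

lemma psum_besselSeries_one_ne_zero {z : ℂ} (hz : ‖z‖ < 2) (h0 : z ≠ 0) :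
    psum (besselSeries 1) z ≠ 0 := by
  rw [psum_besselSeries_one hz]
  exact mul_ne_zero h0 (psum_kernelSeries_ne_zero hz)

lemma hasDerivAt_psum_besselSeries (c : ℝ) (z : ℂ) :
    HasDerivAt (psum (besselSeries c)) (psum (bessel0Series c) z) z :=
  derivative_besselSeries c ▸ (convOn_besselSeries c (‖z‖ + 1)).hasDerivAt (lt_add_one _)

lemma circleIntegral_besselSeries_zpow_of_ne {m : ℤ} (hm : m ≠ 0) {r : ℝ} (h0 : 0 < r)
    (h2 : r < 2) : (∮ z in C(0, r), psum (bessel0Series 1) z *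
      psum (besselSeries 1) z ^ (m - 1)) = 0 := by
  refine circleIntegral.integral_eq_zero_of_hasDerivWithinAt
    (f := fun z => psum (besselSeries 1) z ^ m / m) h0.le fun z hz => ?_
  have hz' : ‖z‖ = r := by simpa using hz
  have hne := psum_besselSeries_one_ne_zero (hz'.trans_lt h2)
    (norm_pos_iff.1 (hz'.symm ▸ h0))
  have h := ((hasDerivAt_zpow m _ (Or.inl hne)).comp z
    (hasDerivAt_psum_besselSeries 1 z)).div_const (m : ℂ)
  refine (h.congr_deriv ?_).hasDerivWithinAt
  have : (m : ℂ) ≠ 0 := Int.cast_ne_zero.2 hm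
  field_simp

lemma circleIntegral_besselSeries_inv {r : ℝ} (h0 : 0 < r) (h2 : r < 2) :
    (∮ z in C(0, r), psum (bessel0Series 1) z * psum (besselSeries 1) z ^ (-1 : ℤ)) =
      2 * π * Complex.I := by
  have hsub : Metric.sphere (0 : ℂ) r ⊆ Metric.ball 0 2 := fun z hz => by
    rw [mem_ball_zero_iff]
    exact (mem_sphere_zero_iff_norm.1 hz).trans_lt h2
  have hE : Set.EqOn (fun z => psum (bessel0Series 1) z * psum (besselSeries 1) z ^ (-1 : ℤ))
      (fun z => (z - 0)⁻¹ - psum logDerivSeries z) (Metric.sphere 0 r) := fun z hz => by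
    have hz' : ‖z‖ = r := by simpa using hz
    have hz2 : ‖z‖ < 2 := hz'.trans_lt h2
    have hz0 : z ≠ 0 := norm_pos_iff.1 (hz'.symm ▸ h0)
    have hF := psum_kernelSeries_ne_zero hz2
    have h1 : ConvOn (1 : ℝ⟦X⟧) 2 := by simpa using convOn_C 1 2
    have hp1 : psum 1 z = 1 := by simpa using psum_C 1 z
    have hX : ConvOn (X * logDerivSeries) 2 := (convOn_X 2).mul convOn_logDerivSeries
    simp only
    rw [psum_besselSeries_one hz2, bessel0Series_one,
      psum_mul (convOn_kernelSeries 2) (h1.sub hX) hz2, psum_sub h1 hX hz2, hp1,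
      psum_mul (convOn_X 2) convOn_logDerivSeries hz2, psum_X, zpow_neg_one, sub_zero]
    field_simp
  have hc : ContinuousOn (psum logDerivSeries) (Metric.sphere 0 r) :=
    convOn_logDerivSeries.differentiableOn.continuousOn.mono hsub
  have hci : ContinuousOn (fun z : ℂ => (z - 0)⁻¹) (Metric.sphere 0 r) :=
    ContinuousOn.inv₀ (by fun_prop) fun z hz => by
      rw [sub_zero]
      exact norm_pos_iff.1 ((mem_sphere_zero_iff_norm.1 hz).symm ▸ h0)
  rw [circleIntegral.integral_congr h0.le hE, circleIntegral.integral_sub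
    (hci.circleIntegrable h0.le) (hc.circleIntegrable h0.le),
    circleIntegral.integral_sub_center_inv _ h0.ne']
  have hz : (∮ z in C(0, r), psum logDerivSeries z) = 0 := by
    refine circleIntegral.integral_eq_zero_of_hasDerivWithinAt (f := psum logKernelSeries) h0.le
      fun z hz => ?_
    have := convOn_logKernelSeries.hasDerivAt (mem_ball_zero_iff.1 (hsub hz))
    rw [derivative_logKernelSeries] at this
    exact this.hasDerivWithinAt
  rw [hz, sub_zero]

/-- The coefficient of index `n` of the expansion of `besselSeries ((θ / π) ^ 2)` in powers of
`besselSeries 1`. -/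
noncomputable def expansionCoeff (θ : ℝ) (n : ℕ) : ℝ :=
  π ^ 2 / (π ^ 2) ^ n * evenEval θ (polyG n)

lemma exists_bessel0Series_expansion (θ : ℝ) (n : ℕ) : ∃ Q : ℝ⟦X⟧, ConvOn Q 2 ∧
    ∀ z : ℂ, ‖z‖ < 2 → psum (bessel0Series ((θ / π) ^ 2)) z =
      ∑ j ∈ Finset.range (n + 1), (expansionCoeff θ j : ℂ) *
        (j * psum (besselSeries 1) z ^ (j - 1) * psum (bessel0Series 1) z) +
      ((n + 1) * z ^ n * psum Q z + z ^ (n + 1) * psum (d⁄dX ℝ Q) z) := by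
  obtain ⟨Q, hQ⟩ : X ^ (n + 1) ∣ besselSeries ((θ / π) ^ 2) - ∑ j ∈ Finset.range (n + 1),
      C (expansionCoeff θ j) * besselSeries 1 ^ j := X_pow_dvd_besselSeries_sub θ n
  have hs : ∀ j, ConvOn (C (expansionCoeff θ j) * besselSeries 1 ^ j) 2 := fun j =>
    (convOn_C _ 2).mul ((convOn_besselSeries 1 2).pow j)
  have hQc : ConvOn Q 2 := by
    refine ConvOn.of_X_pow_mul (N := n + 1) ?_
    rw [← hQ]
    exact (convOn_besselSeries _ 2).sub (convOn_sum _ hs)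
  refine ⟨Q, hQc, fun z hz => ?_⟩
  have hev : psum (besselSeries ((θ / π) ^ 2)) =ᶠ[nhds z] fun w =>
      ∑ j ∈ Finset.range (n + 1), (expansionCoeff θ j : ℂ) * psum (besselSeries 1) w ^ j +
        w ^ (n + 1) * psum Q w := by
    filter_upwards [Metric.isOpen_ball.mem_nhds (mem_ball_zero_iff.2 hz)] with w hw
    have hw := mem_ball_zero_iff.1 hw
    have h := psum_mul ((convOn_X 2).pow (n + 1)) hQc hw
    rw [← hQ, psum_sub (convOn_besselSeries _ 2) (convOn_sum _ hs) hw, psum_sum _ hs hw,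
      psum_pow (convOn_X 2) _ hw, psum_X, sub_eq_iff_eq_add'] at h
    rw [h]
    congr 1
    refine Finset.sum_congr rfl fun j _ => ?_
    rw [psum_mul (convOn_C _ 2) ((convOn_besselSeries 1 2).pow j) hw, psum_C,
      psum_pow (convOn_besselSeries 1 2) _ hw]
  have hd := (HasDerivAt.fun_sum fun j (_ : j ∈ Finset.range (n + 1)) =>
    ((hasDerivAt_psum_besselSeries 1 z).fun_pow j).const_mul (expansionCoeff θ j : ℂ)).add
    ((hasDerivAt_pow (n + 1) z).mul (hQc.hasDerivAt hz))
  have := (hasDerivAt_psum_besselSeries ((θ / π) ^ 2) z).unique (hd.congr_of_eventuallyEq hev)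
  rw [this]
  push_cast
  rfl

lemma circleIntegral_bessel0Series_div (θ : ℝ) (n : ℕ) {r : ℝ} (h0 : 0 < r) (h2 : r < 2) :
    (∮ z in C(0, r), psum (bessel0Series ((θ / π) ^ 2)) z / psum (besselSeries 1) z ^ n) =
      2 * π * Complex.I * (n * expansionCoeff θ n) := by
  obtain ⟨Q, hQ, hexp⟩ := exists_bessel0Series_expansion θ n
  have hcl : Metric.closedBall (0 : ℂ) r ⊆ Metric.ball 0 2 := Metric.closedBall_subset_ball h2
  have hsub : Metric.sphere (0 : ℂ) r ⊆ Metric.ball 0 2 := Metric.sphere_subset_closedBall.trans hcl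
  set R : ℂ → ℂ := fun z => ((n + 1) * psum Q z + z * psum (d⁄dX ℝ Q) z) / psum kernelSeries z ^ n
    with hR
  have hRd : DifferentiableOn ℂ R (Metric.ball 0 2) := by
    have h1 := hQ.differentiableOn
    have h3 := hQ.derivative.differentiableOn
    have h4 := (convOn_kernelSeries 2).differentiableOn
    refine DifferentiableOn.div (by fun_prop) (by fun_prop) fun z hz => ?_
    exact pow_ne_zero _ (psum_kernelSeries_ne_zero (mem_ball_zero_iff.1 hz))
  set T : ℕ → ℂ → ℂ := fun j z => (expansionCoeff θ j * j : ℂ) * (psum (bessel0Series 1) z *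
    psum (besselSeries 1) z ^ ((j - n : ℤ) - 1)) with hT
  have hTc : ∀ j, ContinuousOn (T j) (Metric.sphere 0 r) := fun j => by
    have h1 := ((convOn_bessel0Series 1 2).differentiableOn.continuousOn).mono hsub
    have h3 := ((convOn_besselSeries 1 2).differentiableOn.continuousOn).mono hsub
    refine continuousOn_const.mul (h1.mul (h3.zpow₀ _ fun z hz => Or.inl ?_))
    have hz' := mem_sphere_zero_iff_norm.1 hz
    exact psum_besselSeries_one_ne_zero (hz'.trans_lt h2) (norm_pos_iff.1 (hz'.symm ▸ h0))
  have hE : Set.EqOn (fun z => psum (bessel0Series ((θ / π) ^ 2)) z / psum (besselSeries 1) z ^ n)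
      (fun z => ∑ j ∈ Finset.range (n + 1), T j z + R z) (Metric.sphere 0 r) := fun z hz => by
    have hz' := mem_sphere_zero_iff_norm.1 hz
    have hz2 := hz'.trans_lt h2
    have hz0 : z ≠ 0 := norm_pos_iff.1 (hz'.symm ▸ h0)
    have hs := psum_besselSeries_one_ne_zero hz2 hz0
    have hF := psum_kernelSeries_ne_zero hz2
    simp only [hT, hR]
    rw [hexp z hz2, add_div, Finset.sum_div]
    congr 1
    · refine Finset.sum_congr rfl fun j _ => ?_
      cases j with
      | zero => simp
      | succ j =>
        rw [Nat.add_sub_cancel, show ((j + 1 : ℕ) - n : ℤ) - 1 = (j : ℤ) - n by push_cast; ring,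
          zpow_sub₀ hs, zpow_natCast, zpow_natCast]
        ring
    · rw [psum_besselSeries_one hz2]
      field_simp
      ring
  have hTi : ∀ j, (∮ z in C(0, r), T j z) =
      if j = n then 2 * π * Complex.I * (n * expansionCoeff θ n) else 0 := fun j => by
    simp only [hT]
    rw [circleIntegral.integral_const_mul]
    split_ifs with h
    · rw [h, sub_self, zero_sub, circleIntegral_besselSeries_inv h0 h2]
      ring
    · rw [circleIntegral_besselSeries_zpow_of_ne (sub_ne_zero.2 (mod_cast h)) h0 h2, mul_zero]
  rw [circleIntegral.integral_congr h0.le hE, circleIntegral.integral_add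
    ((continuousOn_finsetSum _ fun j _ => hTc j).circleIntegrable h0.le)
    ((hRd.continuousOn.mono hsub).circleIntegrable h0.le),
    circleIntegral.integral_fun_sum fun j _ => (hTc j).circleIntegrable h0.le,
    (hRd.mono (Metric.closedBall_subset_ball h2)).diffContOnCl_ball subset_rfl
      |>.circleIntegral_eq_zero h0.le]
  simp only [hTi, Finset.sum_ite_eq', Finset.mem_range, Nat.lt_succ_self, if_true, add_zero]

end Contour

section Laplace

open Filter Topology

lemma tendsto_div_sq_of_hasDerivAt {f f' : ℝ → ℂ} (hf : ∀ t, HasDerivAt f (f' t) t)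
    (h0 : f' 0 = 0) {b : ℂ} (hf' : HasDerivAt f' b 0) :
    Tendsto (fun t : ℝ => (f t - f 0) / (t : ℂ) ^ 2) (𝓝[≠] 0) (𝓝 (b / 2)) := by
  have h1 : (fun t => f' t - b * t) =o[𝓝[Set.univ] 0] fun t : ℝ => (t - 0) ^ 1 := by
    rw [nhdsWithin_univ]
    refine ((hasDerivAt_iff_isLittleO.1 hf').congr_left fun t => ?_).congr_right fun t => by ring
    rw [h0, sub_zero, sub_zero, Complex.real_smul, mul_comm]
  have h2 := convex_univ.isLittleO_pow_succ_real (f := fun t : ℝ => f t - b / 2 * (t : ℂ) ^ 2)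
    (Set.mem_univ 0) (fun t _ => by
      have h := (hf t).sub (((Complex.ofRealCLM.hasDerivAt (x := t)).pow 2).const_mul (b / 2))
      refine (h.congr_deriv ?_).hasDerivWithinAt
      simp
      ring) h1
  rw [nhdsWithin_univ] at h2
  have h3 : (fun t : ℝ => f t - f 0 - b / 2 * (t : ℂ) ^ 2) =o[𝓝[≠] 0] fun t => (t : ℂ) ^ 2 :=
    (Asymptotics.isLittleO_norm_right.1 (h2.norm_right.congr
      (fun t => by simp only [Complex.ofReal_zero]; ring) fun t => by simp)).mono
        nhdsWithin_le_nhds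
  refine tendsto_sub_nhds_zero_iff.1 (h3.tendsto_div_nhds_zero.congr' ?_)
  filter_upwards [self_mem_nhdsWithin] with t ht
  have : (t : ℂ) ≠ 0 := Complex.ofReal_ne_zero.2 ht
  field_simp

theorem laplace_tendsto {H q : ℝ → ℂ} (hH : Continuous H) (hq : Continuous q) {a b : ℝ}
    (hb : 0 < b) (hqb : ∀ t, |t| ≤ π → ‖q t‖ ≤ Real.exp (-(b * t ^ 2))) (hq0 : q 0 = 1)
    (hqa : Tendsto (fun t : ℝ => (q t - 1) / (t : ℂ) ^ 2) (𝓝[≠] 0) (𝓝 (-a : ℂ))) :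
    Tendsto (fun n : ℕ => ((√n : ℝ) : ℂ) * ∫ t in (-π)..π, H t * q t ^ n) atTop
      (𝓝 (H 0 * (√(π / a) : ℝ))) := by
  obtain ⟨C, hC⟩ := isCompact_Icc.exists_bound_of_continuousOn
    (hH.continuousOn (s := Set.Icc (-π) π))
  set F : ℕ → ℝ → ℂ := fun n => (Set.Ioc (-(π * √n)) (π * √n)).indicator
    fun u => H (u / √n) * q (u / √n) ^ n with hF
  have hint : ∀ n : ℕ, 0 < n → ((√n : ℝ) : ℂ) * ∫ t in (-π)..π, H t * q t ^ n = ∫ u, F n u := by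
    intro n hn
    have hs : (0 : ℝ) < √n := Real.sqrt_pos.2 (mod_cast hn)
    rw [integral_indicator measurableSet_Ioc, ← intervalIntegral.integral_of_le
      (by nlinarith [pi_pos]), ← neg_mul,
      intervalIntegral.integral_comp_div (fun t => H t * q t ^ n) hs.ne',
      mul_div_cancel_right₀ _ hs.ne', mul_div_cancel_right₀ _ hs.ne', Complex.real_smul]
  have hlim : ∀ u : ℝ, Tendsto (fun n : ℕ => F n u) atTop
      (𝓝 (H 0 * (Real.exp (-a * u ^ 2) : ℂ))) := by
    intro u
    have hsqrt : Tendsto (fun n : ℕ => √(n : ℝ)) atTop atTop :=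
      Real.tendsto_sqrt_atTop.comp tendsto_natCast_atTop_atTop
    have hdiv : Tendsto (fun n : ℕ => u / √(n : ℝ)) atTop (𝓝 0) := hsqrt.const_div_atTop u
    have hpow : Tendsto (fun n : ℕ => q (u / √n) ^ n) atTop
        (𝓝 (Real.exp (-a * u ^ 2) : ℂ)) := by
      rcases eq_or_ne u 0 with rfl | hu
      · simp [hq0]
      · have h1 : Tendsto (fun n : ℕ => u / √(n : ℝ)) atTop (𝓝[≠] 0) :=
          tendsto_nhdsWithin_iff.2 ⟨hdiv, (eventually_gt_atTop 0).mono fun n hn =>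
            div_ne_zero hu (Real.sqrt_pos.2 (mod_cast hn)).ne'⟩
        have h2 := (hqa.comp h1).mul_const ((u : ℂ) ^ 2)
        have h3 : Tendsto (fun n : ℕ => (n : ℂ) * (q (u / √n) - 1)) atTop
            (𝓝 (-a * (u : ℂ) ^ 2)) := by
          refine h2.congr' ((eventually_gt_atTop 0).mono fun n hn => ?_)
          have hn' : (n : ℂ) ≠ 0 := by exact_mod_cast hn.ne'
          have hu' : (u : ℂ) ≠ 0 := by exact_mod_cast hu
          have hsq : ((u / √n : ℝ) : ℂ) ^ 2 = (u : ℂ) ^ 2 / n := by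
            rw [← Complex.ofReal_pow, div_pow, Real.sq_sqrt (Nat.cast_nonneg n)]
            push_cast
            rfl
          simp only [Function.comp_apply]
          rw [hsq]
          field_simp
        have h4 := Complex.tendsto_one_add_pow_exp_of_tendsto h3
        push_cast
        refine h4.congr fun n => ?_
        rw [add_sub_cancel]
    have hmain : Tendsto (fun n : ℕ => H (u / √n) * q (u / √n) ^ n) atTop
        (𝓝 (H 0 * (Real.exp (-a * u ^ 2) : ℂ))) :=
      ((hH.tendsto 0).comp hdiv).mul hpow
    refine hmain.congr' ?_
    filter_upwards [(hsqrt.const_mul_atTop pi_pos).eventually_gt_atTop |u|] with n hn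
    have := abs_lt.1 hn
    simp only [hF]
    rw [Set.indicator_of_mem (show u ∈ Set.Ioc (-(π * √n)) (π * √n) from ⟨this.1, this.2.le⟩)]
  have hbound : ∀ n : ℕ, ∀ u : ℝ, 0 < n → ‖F n u‖ ≤ C * Real.exp (-b * u ^ 2) := by
    intro n u hn
    have hs : (0 : ℝ) < √n := Real.sqrt_pos.2 (mod_cast hn)
    have hC0 : 0 ≤ C := (norm_nonneg _).trans (hC 0 ⟨by linarith [pi_pos], pi_pos.le⟩)
    by_cases hu : u ∈ Set.Ioc (-(π * √n)) (π * √n)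
    · have h1 : -π ≤ u / √n := by rw [le_div_iff₀ hs]; linarith [hu.1]
      have h2 : u / √n ≤ π := by rw [div_le_iff₀ hs]; exact hu.2
      simp only [hF]
      rw [Set.indicator_of_mem hu, norm_mul, norm_pow]
      refine mul_le_mul (hC _ ⟨h1, h2⟩) ?_ (by positivity) hC0
      refine (pow_le_pow_left₀ (norm_nonneg _) (hqb _ (abs_le.2 ⟨h1, h2⟩)) n).trans_eq ?_
      rw [← Real.exp_nat_mul, div_pow, Real.sq_sqrt (Nat.cast_nonneg n)]
      congr 1
      field_simp
    · simp only [hF]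
      rw [Set.indicator_of_notMem hu, norm_zero]
      positivity
  have hdom : Tendsto (fun n : ℕ => ∫ u, F (n + 1) u) atTop
      (𝓝 (∫ u : ℝ, H 0 * (Real.exp (-a * u ^ 2) : ℂ))) := by
    refine tendsto_integral_of_dominated_convergence (fun u => C * Real.exp (-b * u ^ 2))
      (fun n => ?_) ((integrable_exp_neg_mul_sq hb).const_mul C)
      (fun n => Eventually.of_forall fun u => hbound (n + 1) u n.succ_pos)
      (Eventually.of_forall fun u => (tendsto_add_atTop_iff_nat 1).2 (hlim u))
    exact (Continuous.aestronglyMeasurable (by fun_prop)).indicator measurableSet_Ioc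
  rw [integral_const_mul, integral_complex_ofReal, integral_gaussian] at hdom
  rw [← tendsto_add_atTop_iff_nat 1]
  exact hdom.congr fun n => (hint (n + 1) n.succ_pos).symm

end Laplace

section Asymptotics

open Filter Topology

lemma norm_circleMap_zc_lt (t : ℝ) : ‖circleMap 0 zc t‖ < 2 := by
  rw [norm_circleMap_zero, abs_of_pos zc_pos]
  exact zc_lt_two

lemma circleMap_zc_ne_zero (t : ℝ) : circleMap 0 zc t ≠ 0 := circleMap_ne_center zc_pos.ne'

lemma circleMap_zc_zero : circleMap 0 zc 0 = zc := by simp [circleMap]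

/-- The quotient of the value of `besselSeries 1` at `zc` by its value at the point of angle `t`
on the critical circle. -/
noncomputable def circleRatio (t : ℝ) : ℂ :=
  psum (besselSeries 1) zc / psum (besselSeries 1) (circleMap 0 zc t)

lemma psum_circleMap_ne_zero (t : ℝ) : psum (besselSeries 1) (circleMap 0 zc t) ≠ 0 :=
  psum_besselSeries_one_ne_zero (norm_circleMap_zc_lt t) (circleMap_zc_ne_zero t)

lemma psum_zc_ne_zero : psum (besselSeries 1) zc ≠ 0 := by
  simpa [circleMap_zc_zero] using psum_circleMap_ne_zero 0

lemma hasDerivAt_psum_circleMap (t : ℝ) :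
    HasDerivAt (fun t => psum (besselSeries 1) (circleMap 0 zc t))
      (psum (bessel0Series 1) (circleMap 0 zc t) * (circleMap 0 zc t * Complex.I)) t :=
  (hasDerivAt_psum_besselSeries 1 _).comp t (hasDerivAt_circleMap 0 zc t)

lemma continuous_circleRatio : Continuous circleRatio :=
  continuous_const.div
    (continuous_iff_continuousAt.2 fun t => (hasDerivAt_psum_circleMap t).continuousAt)
    psum_circleMap_ne_zero

lemma circleRatio_zero : circleRatio 0 = 1 := by
  rw [circleRatio, circleMap_zc_zero, div_self psum_zc_ne_zero]

lemma norm_circleRatio_le {t : ℝ} (ht : |t| ≤ π) :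
    ‖circleRatio t‖ ≤ Real.exp (-(zc / π ^ 2 * t ^ 2)) := by
  have h := norm_psum_kernelSeries_div_le zc_pos.le zc_lt_two ht
  have hc : circleMap 0 zc t = zc * Complex.exp (t * Complex.I) := by simp [circleMap]
  rw [circleRatio, psum_besselSeries_one norm_zc_lt,
    psum_besselSeries_one (norm_circleMap_zc_lt t), mul_div_mul_comm, norm_mul, norm_div,
    norm_circleMap_zero, Complex.norm_real, Real.norm_eq_abs,
    div_self (abs_ne_zero.2 zc_pos.ne'), one_mul, hc]
  exact h

lemma tendsto_circleRatio : Tendsto (fun t : ℝ => (circleRatio t - 1) / (t : ℂ) ^ 2) (𝓝[≠] 0)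
    (𝓝 (-((zc / 2 : ℝ) : ℂ))) := by
  have hE : HasDerivAt (fun t => psum (bessel0Series 1) (circleMap 0 zc t) *
      (circleMap 0 zc t * Complex.I)) (zc * psum (besselSeries 1) zc) 0 := by
    have h1 := (convOn_bessel0Series 1 2).hasDerivAt (norm_circleMap_zc_lt 0)
    have h2 := (h1.comp (0 : ℝ) (hasDerivAt_circleMap 0 zc 0)).mul
      ((hasDerivAt_circleMap 0 zc 0).mul_const Complex.I)
    refine h2.congr_deriv ?_
    simp only [Function.comp_apply]
    rw [circleMap_zc_zero, psum_bessel0Series_one_zc, derivative_bessel0Series_one, psum_neg,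
      psum_besselSeries_one norm_zc_lt]
    linear_combination (-psum kernelSeries zc * zc ^ 2) * Complex.I_sq
  have h := tendsto_div_sq_of_hasDerivAt hasDerivAt_psum_circleMap
    (by rw [circleMap_zc_zero, psum_bessel0Series_one_zc, zero_mul]) hE
  have hc : Tendsto (fun t => psum (besselSeries 1) (circleMap 0 zc t)) (𝓝[≠] 0)
      (𝓝 (psum (besselSeries 1) zc)) := by
    have := (hasDerivAt_psum_circleMap 0).continuousAt.tendsto
    rw [circleMap_zc_zero] at this
    exact this.mono_left nhdsWithin_le_nhds
  have h2 := (h.div hc psum_zc_ne_zero).neg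
  have hne := psum_zc_ne_zero
  rw [show -((zc / 2 : ℝ) : ℂ) = -((zc : ℂ) * psum (besselSeries 1) zc / 2 /
    psum (besselSeries 1) zc) by push_cast; field_simp]
  refine h2.congr fun t => ?_
  have hs := psum_circleMap_ne_zero t
  simp only [Pi.div_apply, circleRatio, circleMap_zc_zero]
  field_simp
  ring

/-- The amplitude multiplying `circleRatio t ^ n` in the contour integral. -/
noncomputable def amplitude (θ t : ℝ) : ℂ :=
  circleMap 0 zc t * psum (bessel0Series ((θ / π) ^ 2)) (circleMap 0 zc t)

lemma continuous_amplitude (θ : ℝ) : Continuous (amplitude θ) :=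
  (continuous_circleMap 0 zc).mul (continuous_iff_continuousAt.2 fun t =>
    (((convOn_bessel0Series _ 2).hasDerivAt (norm_circleMap_zc_lt t)).comp t
      (hasDerivAt_circleMap 0 zc t)).continuousAt)

lemma integral_amplitude_mul (θ : ℝ) (n : ℕ) :
    ∫ t in (-π)..π, amplitude θ t * circleRatio t ^ n =
      2 * π * (n * expansionCoeff θ n * psum (besselSeries 1) zc ^ n) := by
  have h := circleIntegral_bessel0Series_div θ n zc_pos zc_lt_two
  have hper : Function.Periodic (fun t => amplitude θ t * circleRatio t ^ n) (2 * π) := by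
    intro t
    simp only [amplitude, circleRatio, (periodic_circleMap 0 zc) t]
  have hshift := hper.intervalIntegral_add_eq (-π) 0
  rw [show -π + 2 * π = π by ring, zero_add] at hshift
  rw [hshift]
  have hI : (∫ t in (0)..(2 * π), amplitude θ t * circleRatio t ^ n) * Complex.I =
      (∮ z in C(0, zc), psum (bessel0Series ((θ / π) ^ 2)) z / psum (besselSeries 1) z ^ n) *
        psum (besselSeries 1) zc ^ n := by
    rw [circleIntegral, ← intervalIntegral.integral_mul_const,
      ← intervalIntegral.integral_mul_const]
    refine intervalIntegral.integral_congr fun t _ => ?_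
    simp only [amplitude, circleRatio, deriv_circleMap, smul_eq_mul, div_pow]
    ring
  rw [h] at hI
  refine mul_right_cancel₀ Complex.I_ne_zero ?_
  rw [hI]
  ring

lemma ofReal_coefficient_eq {θ : ℝ} (h0 : 0 ≤ θ) (hπ : θ ≤ π) (n : ℕ) :
    (((n : ℝ) ^ ((3 : ℝ) / 2) * xc ^ n * G n θ : ℝ) : ℂ) =
      (((√n : ℝ) : ℂ) * ∫ t in (-π)..π, amplitude θ t * circleRatio t ^ n) /
        (2 * π ^ 3 : ℝ) := by
  have hn : (n : ℝ) ^ ((3 : ℝ) / 2) = n * √n := by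
    rw [show (3 : ℝ) / 2 = 1 + 1 / 2 by norm_num, Real.rpow_add_of_nonneg (Nat.cast_nonneg n)
      zero_le_one (by norm_num), Real.rpow_one, ← Real.sqrt_eq_rpow]
  have hpi : (π : ℂ) ≠ 0 := Complex.ofReal_ne_zero.2 pi_ne_zero
  rw [integral_amplitude_mul, psum_besselSeries_zc, expansionCoeff, G_eq_evenEval n h0 hπ, hn]
  push_cast
  rw [mul_pow]
  field_simp

lemma limit_eq (J : ℝ) : zc * J * √(π / (zc / 2)) / (2 * π ^ 3) =
    c0 * J / (2 * √2 * π ^ ((5 : ℝ) / 2)) := by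
  have hc := c0_pos
  have hs : √(π / (zc / 2)) = 2 * √2 * √π / c0 := by
    rw [Real.sqrt_eq_iff_mul_self_eq (by have := zc_pos; positivity) (by positivity), zc]
    have h2 := Real.mul_self_sqrt (show (0 : ℝ) ≤ 2 by norm_num)
    have h3 := Real.mul_self_sqrt pi_pos.le
    field_simp
    nlinarith
  have h5 : π ^ ((5 : ℝ) / 2) = π ^ 2 * √π := by
    rw [show (5 : ℝ) / 2 = (2 : ℕ) + 1 / 2 by norm_num, Real.rpow_add pi_pos, Real.rpow_natCast,
      ← Real.sqrt_eq_rpow]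
  rw [hs, h5, zc, div_eq_div_iff (by positivity) (by positivity)]
  have h2 := Real.sq_sqrt (show (0 : ℝ) ≤ 2 by norm_num)
  have h3 := Real.sq_sqrt pi_pos.le
  field_simp
  rw [h2, h3]
  ring

end Asymptotics

/-- Coefficient asymptotics (Lemma 3.3): for every `θ ∈ [0,π)`,
`n^{3/2} x_c^n G_n(θ) → c₀ J₀(θc₀/π) / (2√2 π^{5/2})` as `n → ∞`. -/
theorem coefficient_asymptotics (θ : ℝ) (hθ0 : 0 ≤ θ) (hθπ : θ < Real.pi) :
    Filter.Tendsto (fun n : ℕ => (n : ℝ) ^ ((3 : ℝ) / 2) * xc ^ n * G n θ)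
      Filter.atTop
      (nhds (c0 * J0 (θ * c0 / Real.pi) /
        (2 * Real.sqrt 2 * Real.pi ^ ((5 : ℝ) / 2)))) := by
  have h := (laplace_tendsto (continuous_amplitude θ) continuous_circleRatio
    (div_pos zc_pos (by positivity)) (fun t => norm_circleRatio_le) circleRatio_zero
    tendsto_circleRatio).div_const ((2 * π ^ 3 : ℝ) : ℂ)
  rw [amplitude, circleMap_zc_zero, psum_bessel0Series_zc, ← Complex.ofReal_mul,
    ← Complex.ofReal_mul, ← Complex.ofReal_div, limit_eq] at h
  simp only [← ofReal_coefficient_eq hθ0 hθπ.le] at h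
  exact (Complex.continuous_re.tendsto _).comp h
end

section
/- For every c > 0, the function F_c : [0,∞) → ℝ defined by F_c(θ) = (√c/θ)·J₁(2θ√c) for θ > 0 and F_c(0) = c is continuous on [0,∞), differentiable on (0,∞), and satisfies F_c′(θ) = −∫₀^θ F_c(α)·F_c(θ−α) dα for every θ > 0. (The Bessel solution of the convolution equation (eq:Frecurrencederiv) in the proof of Theorem 3.2 of the paper.) -/
open MeasureTheory Real

/-- For `c > 0`, `F_c(θ) = (√c/θ) J₁(2θ√c)` (with `F_c(0) = c`). -/
noncomputable def Fc (c : ℝ) (θ : ℝ) : ℝ :=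
  if θ = 0 then c else Real.sqrt c / θ * J1 (2 * θ * Real.sqrt c)

theorem catalan_le_four_pow (n : ℕ) : catalan n ≤ 4 ^ n := by
  have h := succ_mul_catalan_eq_centralBinom n
  have h' := Nat.centralBinom_le_four_pow n
  nlinarith [Nat.zero_le (n * catalan n)]

theorem integral_pow_mul_sub_pow (θ : ℝ) (m n : ℕ) :
    ∫ α in (0 : ℝ)..θ, α ^ m / (m.factorial : ℝ) * ((θ - α) ^ n / (n.factorial : ℝ)) =
      θ ^ (m + n + 1) / ((m + n + 1).factorial : ℝ) := by
  induction n generalizing m with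
  | zero =>
    simp only [pow_zero, Nat.factorial_zero, Nat.cast_one, div_one, mul_one, add_zero,
      intervalIntegral.integral_div, integral_pow, Nat.factorial_succ]
    push_cast
    have := Nat.factorial_ne_zero m
    field_simp
    simp
  | succ n ih =>
    have hd : ∀ α ∈ Set.uIcc 0 θ, HasDerivAt
        (fun α : ℝ => α ^ (m + 1) / ((m + 1).factorial : ℝ) *
          ((θ - α) ^ (n + 1) / ((n + 1).factorial : ℝ)))
        (α ^ m / (m.factorial : ℝ) * ((θ - α) ^ (n + 1) / ((n + 1).factorial : ℝ)) -
          α ^ (m + 1) / ((m + 1).factorial : ℝ) * ((θ - α) ^ n / (n.factorial : ℝ))) α := by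
      intro α _
      have h1 := (hasDerivAt_pow (m + 1) α).div_const ((m + 1).factorial : ℝ)
      have h2 := (((hasDerivAt_id α).const_sub θ).pow (n + 1)).div_const ((n + 1).factorial : ℝ)
      refine (h1.mul h2).congr_deriv ?_
      simp only [Nat.factorial_succ, id_eq, Nat.add_sub_cancel, Pi.pow_apply]
      push_cast
      have := Nat.factorial_ne_zero m
      have := Nat.factorial_ne_zero n
      field_simp
      ring
    have h := intervalIntegral.integral_eq_sub_of_hasDerivAt hd
      (Continuous.intervalIntegrable (by fun_prop) _ _)
    rw [intervalIntegral.integral_sub (Continuous.intervalIntegrable (by fun_prop) _ _)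
      (Continuous.intervalIntegrable (by fun_prop) _ _), ih (m + 1)] at h
    simp only [sub_self, ne_eq, Nat.succ_ne_zero, not_false_eq_true, zero_pow, zero_div, mul_zero,
      zero_mul] at h
    rw [sub_eq_zero.1 h]
    congr 2 <;> ring_nf

/-- The coefficient of `θ ^ (2 * k) / (2 * k)!` in the power series of `Fc c`. -/
noncomputable def FcCoeff (c : ℝ) (k : ℕ) : ℝ := (-1) ^ k * c ^ (k + 1) * catalan k

theorem sum_antidiagonal_FcCoeff (c : ℝ) (n : ℕ) :
    ∑ p ∈ Finset.HasAntidiagonal.antidiagonal n, FcCoeff c p.1 * FcCoeff c p.2 =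
      -FcCoeff c (n + 1) := by
  rw [FcCoeff, catalan_succ']
  push_cast
  rw [Finset.mul_sum, ← Finset.sum_neg_distrib]
  refine Finset.sum_congr rfl fun p hp => ?_
  rw [← Finset.HasAntidiagonal.mem_antidiagonal.1 hp, FcCoeff, FcCoeff]
  ring

theorem abs_FcCoeff_le {c : ℝ} (hc : 0 ≤ c) (k : ℕ) : |FcCoeff c k| ≤ c * (4 * c) ^ k := by
  have h : (catalan k : ℝ) ≤ 4 ^ k := by exact_mod_cast catalan_le_four_pow k
  rw [FcCoeff, abs_mul, abs_mul, abs_pow, abs_neg, abs_one, one_pow, one_mul, Nat.abs_cast,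
    abs_of_nonneg (by positivity)]
  calc c ^ (k + 1) * (catalan k : ℝ) ≤ c ^ (k + 1) * 4 ^ k := by gcongr
    _ = c * (4 * c) ^ k := by ring

theorem abs_FcCoeff_mul_le {c R θ : ℝ} (hc : 0 ≤ c) (hθ : |θ| ≤ R) (k : ℕ) :
    |FcCoeff c k * (θ ^ (2 * k) / ((2 * k).factorial : ℝ))| ≤
      c * ((4 * c * R ^ 2) ^ k / (k.factorial : ℝ)) := by
  rw [abs_mul, abs_div, abs_pow, Nat.abs_cast]
  have hR : 0 ≤ R := (abs_nonneg θ).trans hθ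
  calc |FcCoeff c k| * (|θ| ^ (2 * k) / ((2 * k).factorial : ℝ))
      ≤ (c * (4 * c) ^ k) * (R ^ (2 * k) / (k.factorial : ℝ)) := by
        gcongr
        · exact abs_FcCoeff_le hc k
        · omega
    _ = c * ((4 * c * R ^ 2) ^ k / (k.factorial : ℝ)) := by
        rw [mul_pow (4 * c), ← pow_mul]; ring

theorem abs_FcCoeff_mul_deriv_le {c R θ : ℝ} (hc : 0 ≤ c) (hR : 1 ≤ R) (hθ : |θ| ≤ R) (k : ℕ) :
    |FcCoeff c k * (((2 * k : ℕ) : ℝ) * θ ^ (2 * k - 1) / ((2 * k).factorial : ℝ))| ≤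
      c * ((16 * c * R ^ 2) ^ k / (k.factorial : ℝ)) := by
  rw [abs_mul, abs_div, abs_mul, abs_pow, Nat.abs_cast, Nat.abs_cast]
  have h2 : ((2 * k : ℕ) : ℝ) ≤ 4 ^ k := by
    have : 2 * k < 2 ^ (2 * k) := Nat.lt_two_pow_self
    rw [pow_mul] at this
    exact_mod_cast this.le
  have hp : |θ| ^ (2 * k - 1) ≤ R ^ (2 * k) :=
    (pow_le_pow_left₀ (abs_nonneg θ) hθ _).trans (pow_le_pow_right₀ hR (by omega))
  calc |FcCoeff c k| * (((2 * k : ℕ) : ℝ) * |θ| ^ (2 * k - 1) / ((2 * k).factorial : ℝ))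
      ≤ (c * (4 * c) ^ k) * (4 ^ k * R ^ (2 * k) / (k.factorial : ℝ)) := by
        gcongr
        · exact abs_FcCoeff_le hc k
        · omega
    _ = c * ((16 * c * R ^ 2) ^ k / (k.factorial : ℝ)) := by
        rw [show (16 : ℝ) * c * R ^ 2 = (4 * c) * (4 * R ^ 2) by ring, mul_pow (4 * c),
          mul_pow 4 (R ^ 2), ← pow_mul]
        ring

theorem summable_FcCoeff_mul {c : ℝ} (hc : 0 ≤ c) (θ : ℝ) :
    Summable fun k : ℕ => ‖FcCoeff c k * (θ ^ (2 * k) / ((2 * k).factorial : ℝ))‖ :=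
  Summable.of_nonneg_of_le (fun _ => norm_nonneg _) (fun k => abs_FcCoeff_mul_le hc le_rfl k)
    ((Real.summable_pow_div_factorial _).mul_left c)

theorem Fc_eq_tsum {c : ℝ} (hc : 0 ≤ c) (θ : ℝ) :
    Fc c θ = ∑' k : ℕ, FcCoeff c k * (θ ^ (2 * k) / ((2 * k).factorial : ℝ)) := by
  rw [Fc]
  split_ifs with h
  · subst h
    rw [tsum_eq_single 0]
    · simp [FcCoeff]
    · intro k hk
      simp [hk]
  · rw [J1, ← tsum_mul_left]
    refine tsum_congr fun k => ?_
    have hcat : ((k + 1 : ℕ) : ℝ) * (catalan k : ℝ) * k.factorial * k.factorial =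
        ((2 * k).factorial : ℝ) := by
      have h1 := succ_mul_catalan_eq_centralBinom k
      have h2 := Nat.add_choose_mul_factorial_mul_factorial k k
      rw [← two_mul, ← Nat.centralBinom_eq_two_mul_choose, ← h1] at h2
      exact_mod_cast h2
    have hs : √c ^ (2 * k + 2) = c ^ (k + 1) := by
      rw [show 2 * k + 2 = 2 * (k + 1) by ring, pow_mul, Real.sq_sqrt hc]
    have hf := Nat.factorial_ne_zero k
    have hcat0 : (catalan k : ℝ) ≠ 0 := by
      intro h0
      rw [h0, mul_zero, zero_mul, zero_mul] at hcat
      exact (2 * k).factorial_ne_zero (by exact_mod_cast hcat.symm)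
    rw [FcCoeff, ← hcat, ← hs, Nat.factorial_succ, show 2 * θ * √c / 2 = θ * √c by ring]
    push_cast
    have : (k : ℝ) + 1 ≠ 0 := by positivity
    field_simp
    ring

theorem hasDerivAt_Fc {c : ℝ} (hc : 0 ≤ c) (θ : ℝ) :
    HasDerivAt (Fc c)
      (∑' n : ℕ, FcCoeff c (n + 1) * (θ ^ (2 * n + 1) / ((2 * n + 1).factorial : ℝ))) θ := by
  set R := |θ| + 1
  have hR : 1 ≤ R := by simp [R]
  have hu := (Real.summable_pow_div_factorial (16 * c * R ^ 2)).mul_left c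
  have hb : ∀ (k : ℕ), ∀ y ∈ Metric.ball (0 : ℝ) R,
      ‖FcCoeff c k * (((2 * k : ℕ) : ℝ) * y ^ (2 * k - 1) / ((2 * k).factorial : ℝ))‖ ≤
        c * ((16 * c * R ^ 2) ^ k / (k.factorial : ℝ)) := fun k y hy =>
    abs_FcCoeff_mul_deriv_le hc hR (by simpa using (mem_ball_zero_iff.1 hy).le) k
  have hθ : θ ∈ Metric.ball (0 : ℝ) R := by simp [R]
  have key := hasDerivAt_tsum_of_isPreconnected hu Metric.isOpen_ball
    (convex_ball (0 : ℝ) R).isPreconnected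
    (fun k y _ => ((hasDerivAt_pow (2 * k) y).div_const ((2 * k).factorial : ℝ)).const_mul
      (FcCoeff c k)) hb hθ (summable_FcCoeff_mul hc θ).of_norm hθ
  rw [← funext (Fc_eq_tsum hc)] at key
  refine key.congr_deriv ?_
  rw [(Summable.of_norm_bounded hu fun k => hb k θ hθ).tsum_eq_zero_add]
  simp only [mul_zero, Nat.cast_zero, zero_mul, zero_div, zero_add]
  refine tsum_congr fun n => ?_
  rw [show 2 * (n + 1) = 2 * n + 1 + 1 by ring, Nat.factorial_succ (2 * n + 1),
    Nat.add_sub_cancel]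
  push_cast
  have := Nat.factorial_ne_zero (2 * n + 1)
  field_simp

theorem hasSum_integral_Fc_mul_Fc {c : ℝ} (hc : 0 ≤ c) {θ : ℝ} (hθ : 0 ≤ θ) :
    HasSum (fun n : ℕ =>
        -(FcCoeff c (n + 1) * (θ ^ (2 * n + 1) / ((2 * n + 1).factorial : ℝ))))
      (∫ α in (0 : ℝ)..θ, Fc c α * Fc c (θ - α)) := by
  set t : ℕ → ℝ → ℝ := fun k α => FcCoeff c k * (α ^ (2 * k) / ((2 * k).factorial : ℝ)) with ht
  set b : ℕ → ℝ := fun k => c * ((4 * c * θ ^ 2) ^ k / (k.factorial : ℝ))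
  have hb0 : ∀ k, 0 ≤ b k := fun k => by positivity
  have hbs : Summable fun k => ‖b k‖ := ((Real.summable_pow_div_factorial _).mul_left c).norm
  have hcont : ∀ k, Continuous (t k) := fun k => by fun_prop
  have htb : ∀ k, ∀ α ∈ Set.uIoc 0 θ, ‖t k α‖ ≤ b k ∧ ‖t k (θ - α)‖ ≤ b k := by
    intro k α hα
    rw [Set.uIoc_of_le hθ] at hα
    exact ⟨abs_FcCoeff_mul_le hc (abs_le.2 ⟨by linarith [hα.1], hα.2⟩) k,
      abs_FcCoeff_mul_le hc (abs_le.2 ⟨by linarith [hα.2], by linarith [hα.1]⟩) k⟩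
  have key := intervalIntegral.hasSum_integral_of_dominated_convergence (μ := volume)
    (a := 0) (b := θ)
    (F := fun n α => ∑ p ∈ Finset.HasAntidiagonal.antidiagonal n, t p.1 α * t p.2 (θ - α))
    (f := fun α => Fc c α * Fc c (θ - α))
    (fun n _ => ∑ p ∈ Finset.HasAntidiagonal.antidiagonal n, b p.1 * b p.2)
    (fun n => Continuous.aestronglyMeasurable (by fun_prop))
    (fun n => .of_forall fun α hα => by
      refine (norm_sum_le _ _).trans (Finset.sum_le_sum fun p _ => ?_)
      rw [norm_mul]
      exact mul_le_mul (htb _ α hα).1 (htb _ α hα).2 (norm_nonneg _) (hb0 _))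
    (.of_forall fun _ _ => (summable_norm_sum_mul_antidiagonal_of_summable_norm hbs hbs).of_norm)
    intervalIntegrable_const
    (.of_forall fun α _ => by
      have h1 := summable_FcCoeff_mul hc α
      have h2 := summable_FcCoeff_mul hc (θ - α)
      rw [Fc_eq_tsum hc, Fc_eq_tsum hc,
        tsum_mul_tsum_eq_tsum_sum_antidiagonal_of_summable_norm h1 h2]
      exact (summable_norm_sum_mul_antidiagonal_of_summable_norm h1 h2).of_norm.hasSum)
  refine (congrArg (HasSum · _) (funext fun n => ?_)).mpr key
  rw [intervalIntegral.integral_finsetSum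
    fun p _ => Continuous.intervalIntegrable (by fun_prop) _ _, ← neg_mul,
    ← sum_antidiagonal_FcCoeff, Finset.sum_mul]
  refine Finset.sum_congr rfl fun p hp => ?_
  rw [← Finset.HasAntidiagonal.mem_antidiagonal.1 hp, mul_add, ← integral_pow_mul_sub_pow,
    ← intervalIntegral.integral_const_mul]
  simp only [ht]
  congr 1 with α
  ring

/-- The Bessel solution of the convolution equation (eq:Frecurrencederiv):
`F_c` is continuous on `[0,∞)`, differentiable on `(0,∞)`, and satisfies
`F_c′(θ) = -∫₀^θ F_c(α) F_c(θ-α) dα` for `θ > 0`. -/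
theorem bessel_solution_convolution_ODE (c : ℝ) (hc : 0 < c) :
    ContinuousOn (Fc c) (Set.Ici 0) ∧
    DifferentiableOn ℝ (Fc c) (Set.Ioi 0) ∧
    ∀ θ : ℝ, 0 < θ →
      HasDerivAt (Fc c) (-∫ α in (0:ℝ)..θ, Fc c α * Fc c (θ - α)) θ := by
  have hd : ∀ θ, DifferentiableAt ℝ (Fc c) θ := fun θ => (hasDerivAt_Fc hc.le θ).differentiableAt
  refine ⟨fun θ _ => (hd θ).continuousAt.continuousWithinAt,
    fun θ _ => (hd θ).differentiableWithinAt, fun θ hθ => ?_⟩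
  refine (hasDerivAt_Fc hc.le θ).congr_deriv ?_
  rw [← (hasSum_integral_Fc_mul_Fc hc.le hθ.le).tsum_eq, tsum_neg, neg_neg]
end
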